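/- arXiv:1909.00364 — 3 statements merged into one kernel-verified Lean document; each statement's English description precedes it below -/
import Mathlib

section
/- The identity ∑_{u,v,n ≥ 0} B(u,v,n) a^u b^v q^n = (−aq;q)_∞ (−bq;q)_∞ holds (as formal power series, or for |q| < 1 and |a|, |b| small), where B(u,v,n) is the number of colored partitions of n (as defined in the context) with exactly u parts of color a or ab and exactly v parts of color b or ab. -/
/-- The three colors `ab < a < b` used in the Alladi–Gordon refinement of Schur's theorem. -/
inductive C3 : Type
  | ab | a | b
  deriving DecidableEq

/-- Index realizing the color order `ab < a < b`. -/
def C3.idx : C3 → ℕ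
  | .ab => 0
  | .a => 1
  | .b => 2

/-- Minimal difference table `D` (row = color of `λ_i`, column = color of `λ_{i+1}`). -/
def D3 : C3 → C3 → ℕ
  | .a, .a => 1
  | .a, .b => 2
  | .a, .ab => 1
  | .b, _ => 1
  | .ab, _ => 2

/-- Lexicographic (strict) order on colored parts: larger size, or equal size and larger color. -/
def LexGt3 (x y : ℕ × C3) : Prop :=
  y.1 < x.1 ∨ (x.1 = y.1 ∧ y.2.idx < x.2.idx)

/-- A colored partition: a lexicographically decreasing sequence of colored parts of positive
size, with no part `1_ab`, whose consecutive size differences are at least given by `D3`. -/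
def IsColored3 (l : List (ℕ × C3)) : Prop :=
  (∀ x ∈ l, 0 < x.1) ∧ (1, C3.ab) ∉ l ∧
    l.Chain' (fun x y => LexGt3 x y ∧ y.1 + D3 x.2 y.2 ≤ x.1)

/-- Colors containing `a`. -/
def C3.inA : C3 → Bool
  | .a => true
  | .ab => true
  | _ => false

/-- Colors containing `b`. -/
def C3.inB : C3 → Bool
  | .b => true
  | .ab => true
  | _ => false


/-- `B(u,v,n)`: the number of colored partitions of `n` with `u` parts of color `a` or `ab`
and `v` parts of color `b` or `ab`. -/
noncomputable def B3 (u v n : ℕ) : ℕ :=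
  Nat.card {l : List (ℕ × C3) // IsColored3 l ∧ (l.map Prod.fst).sum = n ∧
    l.countP (fun x => x.2.inA) = u ∧ l.countP (fun x => x.2.inB) = v}

namespace AlladiGordon

open Finset Filter Topology

section Algebra

variable {R : Type*} [CommRing R]

/-- The elementary symmetric polynomial of degree `u` in `q, q ^ 2, …, q ^ N`. -/
def esymmPow (q : R) : ℕ → ℕ → R
  | _, 0 => 1
  | 0, _ + 1 => 0
  | N + 1, u + 1 => esymmPow q N (u + 1) + q ^ (N + 1) * esymmPow q N u

/-- The finite product `(1 + x q) ⋯ (1 + x q ^ N)`. -/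
def qProd (q x : R) (N : ℕ) : R := ∏ k ∈ range N, (1 + x * q ^ (k + 1))

lemma esymmPow_zero_right (q : R) (N : ℕ) : esymmPow q N 0 = 1 := by
  cases N <;> rfl

lemma esymmPow_succ_succ (q : R) (N u : ℕ) :
    esymmPow q (N + 1) (u + 1) = esymmPow q N (u + 1) + q ^ (N + 1) * esymmPow q N u := rfl

lemma esymmPow_eq_zero (q : R) {N u : ℕ} (h : N < u) : esymmPow q N u = 0 := by
  induction N generalizing u with
  | zero =>
    obtain ⟨u, rfl⟩ := Nat.exists_eq_succ_of_ne_zero (by omega : u ≠ 0)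
    rfl
  | succ N ih =>
    obtain ⟨u, rfl⟩ := Nat.exists_eq_succ_of_ne_zero (by omega : u ≠ 0)
    rw [Nat.succ_eq_add_one, esymmPow_succ_succ, ih (by omega), ih (by omega)]
    simp

lemma qProd_succ (q x : R) (N : ℕ) :
    qProd q x (N + 1) = qProd q x N * (1 + x * q ^ (N + 1)) :=
  prod_range_succ _ _

lemma esymmPow_absorb (q : R) (N u : ℕ) :
    (1 - q ^ (u + 1)) * esymmPow q (N + 1) (u + 1) =
      q ^ (u + 1) * (1 - q ^ (N + 1)) * esymmPow q N u := by
  induction N generalizing u with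
  | zero =>
    cases u with
    | zero => simp [esymmPow]; ring
    | succ u => simp [esymmPow]
  | succ N ih =>
    cases u with
    | zero =>
      have h := ih 0
      simp only [esymmPow_succ_succ, esymmPow_zero_right] at h ⊢
      linear_combination h
    | succ u =>
      have h := ih (u + 1)
      have h' := ih u
      rw [esymmPow_succ_succ q (N + 1) (u + 1)]
      have hp := esymmPow_succ_succ q N u
      linear_combination h + q ^ (N + 2) * h' - (q * q ^ (u + 1) * (1 - q ^ (N + 1))) * hp

lemma sum_esymmPow (q x : R) (N : ℕ) {K : ℕ} (hK : N < K) :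
    ∑ u ∈ range K, esymmPow q N u * x ^ u = qProd q x N := by
  induction N generalizing K with
  | zero =>
    obtain ⟨K, rfl⟩ := Nat.exists_eq_succ_of_ne_zero (by omega : K ≠ 0)
    rw [Nat.succ_eq_add_one, sum_range_succ']
    simp [esymmPow, qProd]
  | succ N ih =>
    obtain ⟨K, rfl⟩ := Nat.exists_eq_succ_of_ne_zero (by omega : K ≠ 0)
    have h1 := ih (K := K + 1) (by omega)
    have h2 := ih (K := K) (by omega)
    rw [sum_range_succ'] at h1
    rw [Nat.succ_eq_add_one, sum_range_succ', qProd_succ, mul_add, mul_one]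
    nth_rewrite 1 [← h1]
    rw [← h2, sum_mul]
    simp only [esymmPow_succ_succ, esymmPow_zero_right, add_mul, sum_add_distrib]
    have : ∑ u ∈ range K, q ^ (N + 1) * esymmPow q N u * x ^ (u + 1) =
        ∑ u ∈ range K, esymmPow q N u * x ^ u * (x * q ^ (N + 1)) :=
      sum_congr rfl fun u _ => by ring
    rw [this]
    ring

lemma esymmPow_mul_qProd_rec (q b : R) (N u : ℕ) :
    esymmPow q (N + 2) (u + 1) * qProd q b (N + 2 - (u + 1)) =
      (1 + b * q ^ (N + 2)) * (esymmPow q (N + 1) (u + 1) * qProd q b (N + 1 - (u + 1))) +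
      q ^ (N + 2) * (esymmPow q (N + 1) u * qProd q b (N + 1 - u)) +
      b * q ^ (N + 2) * (1 - q ^ (N + 1)) * (esymmPow q N u * qProd q b (N - u)) := by
  rcases le_or_gt u N with h | h
  · obtain ⟨m, rfl⟩ := Nat.exists_eq_add_of_le h
    have e1 : u + m + 2 - (u + 1) = m + 1 := by omega
    have e2 : u + m + 1 - (u + 1) = m := by omega
    have e3 : u + m + 1 - u = m + 1 := by omega
    have e4 : u + m - u = m := by omega
    rw [e1, e2, e3, e4, esymmPow_succ_succ q (u + m + 1) u, qProd_succ]
    have h := esymmPow_absorb q (u + m) u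
    linear_combination (qProd q b m * b * q ^ (m + 1)) * h
  · rw [esymmPow_succ_succ q (N + 1) u, esymmPow_eq_zero q (show N + 1 < u + 1 by omega),
      esymmPow_eq_zero q h]
    have e1 : N + 2 - (u + 1) = N + 1 - u := by omega
    rw [e1]
    ring

/-- The polynomials in `a`, `b`, `q` counting colored partitions with all sizes at most `N`, as a
sum over the power of `a`. -/
def colSum (q a b : R) (N : ℕ) : R :=
  ∑ u ∈ range (N + 1), esymmPow q N u * qProd q b (N - u) * a ^ u

lemma colSum_eq (q a b : R) {N K : ℕ} (hK : N < K) :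
    colSum q a b N = ∑ u ∈ range K, esymmPow q N u * qProd q b (N - u) * a ^ u := by
  refine sum_subset (range_mono hK) fun u _ hu => ?_
  rw [esymmPow_eq_zero q (by simpa using hu)]
  simp

lemma colSum_rec (q a b : R) (N : ℕ) :
    colSum q a b (N + 2) =
      (1 + a * q ^ (N + 2) + b * q ^ (N + 2)) * colSum q a b (N + 1) +
        a * b * q ^ (N + 2) * (1 - q ^ (N + 1)) * colSum q a b N := by
  have h1 : colSum q a b (N + 1) = _ := colSum_eq q a b (show N + 1 < (N + 2) + 1 by omega)
  rw [sum_range_succ'] at h1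
  have h2 : colSum q a b (N + 1) = _ := colSum_eq q a b (show N + 1 < N + 2 by omega)
  have h3 : colSum q a b N = _ := colSum_eq q a b (show N < N + 2 by omega)
  have key : ∑ u ∈ range (N + 2),
      esymmPow q (N + 2) (u + 1) * qProd q b (N + 2 - (u + 1)) * a ^ (u + 1) =
      (1 + b * q ^ (N + 2)) * ∑ u ∈ range (N + 2),
        esymmPow q (N + 1) (u + 1) * qProd q b (N + 1 - (u + 1)) * a ^ (u + 1) +
      a * q ^ (N + 2) * ∑ u ∈ range (N + 2),
        esymmPow q (N + 1) u * qProd q b (N + 1 - u) * a ^ u +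
      a * b * q ^ (N + 2) * (1 - q ^ (N + 1)) * ∑ u ∈ range (N + 2),
        esymmPow q N u * qProd q b (N - u) * a ^ u := by
    rw [mul_sum, mul_sum, mul_sum, ← sum_add_distrib, ← sum_add_distrib]
    refine sum_congr rfl fun u _ => ?_
    rw [esymmPow_mul_qProd_rec]
    ring
  rw [← h2, ← h3] at key
  rw [colSum, sum_range_succ', key]
  simp only [esymmPow_zero_right, Nat.sub_zero, pow_zero, mul_one, one_mul] at h1 ⊢
  rw [qProd_succ q b (N + 1)]
  linear_combination (-(1 + b * q ^ (N + 2))) * h1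

end Algebra

section Combinatorics

lemma isColored3_iff (l : List (ℕ × C3)) : IsColored3 l ↔
    (∀ x ∈ l, 0 < x.1) ∧ (1, C3.ab) ∉ l ∧
      l.IsChain (fun x y => LexGt3 x y ∧ y.1 + D3 x.2 y.2 ≤ x.1) :=
  Iff.rfl

lemma isColored3_nil : IsColored3 [] := by
  simp [isColored3_iff]

lemma isColored3_cons (x : ℕ × C3) (l : List (ℕ × C3)) :
    IsColored3 (x :: l) ↔ 0 < x.1 ∧ x ≠ (1, C3.ab) ∧
      (∀ y ∈ l.head?, y.1 + D3 x.2 y.2 ≤ x.1) ∧ IsColored3 l := by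
  have hD : ∀ c d, 0 < D3 c d := by intro c d; cases c <;> cases d <;> simp [D3]
  have hlex : ∀ y : ℕ × C3, (LexGt3 x y ∧ y.1 + D3 x.2 y.2 ≤ x.1) ↔ y.1 + D3 x.2 y.2 ≤ x.1 :=
    fun y => ⟨And.right, fun h => ⟨Or.inl (by have := hD x.2 y.2; omega), h⟩⟩
  rw [isColored3_iff, isColored3_iff, List.isChain_cons]
  simp only [hlex, List.mem_cons, not_or, forall_eq_or_imp, ne_eq, eq_comm (a := x)]
  tauto

/-- The colored partitions with all sizes less than `n`; empty for `n = 0`. -/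
def bounded : ℕ → Finset (List (ℕ × C3))
  | 0 => ∅
  | 1 => {[]}
  | n + 2 => bounded (n + 1) ∪ (bounded (n + 1)).image (List.cons (n + 1, C3.b)) ∪
      (bounded (n + 1) \ (bounded n).image (List.cons (n, C3.b))).image (List.cons (n + 1, C3.a)) ∪
      (bounded n).image (List.cons (n + 1, C3.ab))

lemma mem_bounded (n : ℕ) (l : List (ℕ × C3)) :
    l ∈ bounded n ↔ IsColored3 l ∧ 0 < n ∧ ∀ y ∈ l.head?, y.1 < n := by
  induction n using Nat.twoStepInduction generalizing l with
  | zero => simp [bounded]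
  | one =>
    cases l with
    | nil => simp [bounded, isColored3_nil]
    | cons x t =>
      simp only [bounded, mem_singleton, isColored3_cons]
      simp
      omega
  | more n ih0 ih1 =>
    cases l with
    | nil => simp [bounded, isColored3_nil, ih1]
    | cons x t =>
      obtain ⟨k, c⟩ := x
      simp only [bounded, mem_union, mem_image, ih1, ih0, List.cons.injEq,
        Prod.mk.injEq]
      cases t with
      | nil => cases c <;> simp [ih0, ih1, isColored3_cons, isColored3_nil] <;> grind
      | cons y t =>
        obtain ⟨j, d⟩ := y
        cases c <;> cases d <;> simp [ih0, ih1, isColored3_cons, D3] <;> grind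

variable {R : Type*} [CommRing R]

/-- The monomial in `a`, `b`, `q` attached to a colored partition. -/
def weight (q a b : R) (l : List (ℕ × C3)) : R :=
  a ^ l.countP (fun x => x.2.inA) * b ^ l.countP (fun x => x.2.inB) * q ^ (l.map Prod.fst).sum

lemma weight_cons_a (q a b : R) (n : ℕ) (l : List (ℕ × C3)) :
    weight q a b ((n, C3.a) :: l) = a * q ^ n * weight q a b l := by
  simp [weight, C3.inA, C3.inB]; ring

lemma weight_cons_b (q a b : R) (n : ℕ) (l : List (ℕ × C3)) :
    weight q a b ((n, C3.b) :: l) = b * q ^ n * weight q a b l := by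
  simp [weight, C3.inA, C3.inB]; ring

lemma weight_cons_ab (q a b : R) (n : ℕ) (l : List (ℕ × C3)) :
    weight q a b ((n, C3.ab) :: l) = a * b * q ^ n * weight q a b l := by
  simp [weight, C3.inA, C3.inB]; ring

lemma image_cons_subset_bounded (n : ℕ) :
    (bounded n).image (List.cons (n, C3.b)) ⊆ bounded (n + 1) := by
  cases n with
  | zero => simp [bounded]
  | succ n =>
    intro l hl
    simp only [bounded, mem_union]
    exact .inl (.inl (.inr hl))

lemma sum_weight_rec (q a b : R) (n : ℕ) :
    ∑ l ∈ bounded (n + 2), weight q a b l =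
      (1 + a * q ^ (n + 1) + b * q ^ (n + 1)) * ∑ l ∈ bounded (n + 1), weight q a b l +
        a * b * q ^ (n + 1) * (1 - q ^ n) * ∑ l ∈ bounded n, weight q a b l := by
  have hlt : ∀ c t, ((n + 1, c) :: t : List (ℕ × C3)) ∉ bounded (n + 1) := by
    intro c t h
    have := ((mem_bounded _ _).1 h).2.2 _ rfl
    simp at this
  have hinj : ∀ (x : ℕ × C3) (s : Set (List (ℕ × C3))), Set.InjOn (List.cons x) s :=
    fun x s => (List.cons_injective).injOn
  have hsd := sum_sdiff (f := weight q a b) (image_cons_subset_bounded n)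
  rw [sum_image (hinj _ _)] at hsd
  rw [bounded, sum_union, sum_union, sum_union, sum_image (hinj _ _), sum_image (hinj _ _),
    sum_image (hinj _ _)]
  · simp only [weight_cons_a, weight_cons_b, weight_cons_ab, ← mul_sum] at hsd ⊢
    linear_combination a * q ^ (n + 1) * hsd
  all_goals
    rw [disjoint_left]
    intro l hl hl'
    simp only [mem_union, mem_image] at hl hl'
    grind

lemma sum_weight_eq (q a b : R) (N : ℕ) :
    ∑ l ∈ bounded (N + 1), weight q a b l = colSum q a b N := by
  induction N using Nat.twoStepInduction with
  | zero => simp [bounded, colSum, weight, esymmPow, qProd]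
  | one =>
    rw [sum_weight_rec]
    simp [bounded, colSum, weight, esymmPow, qProd, sum_range_succ]
    ring
  | more N ih0 ih1 => rw [sum_weight_rec, ih0, ih1, colSum_rec]

end Combinatorics

section Analysis

lemma esymmPow_nonneg {r : ℝ} (hr : 0 ≤ r) (N u : ℕ) : 0 ≤ esymmPow r N u := by
  induction N generalizing u with
  | zero => cases u <;> simp [esymmPow]
  | succ N ih =>
    cases u with
    | zero => simp [esymmPow]
    | succ u =>
      rw [esymmPow_succ_succ]
      have := ih u
      have := ih (u + 1)
      positivity

lemma norm_esymmPow_le (q : ℂ) (N u : ℕ) : ‖esymmPow q N u‖ ≤ esymmPow ‖q‖ N u := by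
  induction N generalizing u with
  | zero => cases u <;> simp [esymmPow]
  | succ N ih =>
    cases u with
    | zero => simp [esymmPow]
    | succ u =>
      rw [esymmPow_succ_succ, esymmPow_succ_succ]
      refine (norm_add_le _ _).trans (add_le_add (ih _) ?_)
      rw [norm_mul, norm_pow]
      exact mul_le_mul_of_nonneg_left (ih u) (by positivity)

lemma tendsto_qProd {𝕜 : Type*} [RCLike 𝕜] {q : 𝕜} (hq : ‖q‖ < 1) (x : 𝕜) :
    Tendsto (qProd q x) atTop (𝓝 (∏' k : ℕ, (1 + x * q ^ (k + 1)))) := by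
  have hs : Summable fun k : ℕ => ‖x * q ^ (k + 1)‖ := by
    simp only [norm_mul, norm_pow, pow_succ]
    exact ((summable_geometric_of_lt_one (norm_nonneg q) hq).mul_right _).mul_left _
  exact (multipliable_one_add_of_summable hs).hasProd.tendsto_prod_nat

lemma exists_norm_qProd_le {𝕜 : Type*} [RCLike 𝕜] {q : 𝕜} (hq : ‖q‖ < 1) (x : 𝕜) :
    ∃ C, 0 ≤ C ∧ ∀ N, ‖qProd q x N‖ ≤ C := by
  obtain ⟨C, hC⟩ := (tendsto_qProd hq x).norm.bddAbove_range
  have h : ∀ N, ‖qProd q x N‖ ≤ C := fun N => hC ⟨N, rfl⟩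
  exact ⟨C, (norm_nonneg _).trans (h 0), h⟩

lemma exists_esymmPow_le {r : ℝ} (hr : 0 ≤ r) (hr1 : r < 1) :
    ∃ C, 0 ≤ C ∧ ∀ N u, esymmPow r N u ≤ C := by
  obtain ⟨C, hC0, hC⟩ := exists_norm_qProd_le (q := r) (by rwa [Real.norm_of_nonneg hr]) 1
  refine ⟨C, hC0, fun N u => ?_⟩
  refine le_trans ?_ ((le_abs_self _).trans (hC N))
  rw [← sum_esymmPow r 1 N (show N < N + u + 1 by omega)]
  simp only [one_pow, mul_one]
  exact single_le_sum (f := esymmPow r N) (fun i _ => esymmPow_nonneg hr N i)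
    (mem_range.2 (by omega))

lemma exists_norm_esymmPow_le {q : ℂ} (hq : ‖q‖ < 1) :
    ∃ C, 0 ≤ C ∧ ∀ N u, ‖esymmPow q N u‖ ≤ C := by
  obtain ⟨C, h0, hC⟩ := exists_esymmPow_le (norm_nonneg q) hq
  exact ⟨C, h0, fun N u => (norm_esymmPow_le q N u).trans (hC N u)⟩

lemma tendsto_colSum {q a : ℂ} (hq : ‖q‖ < 1) (ha : ‖a‖ < 1) (b : ℂ) :
    Tendsto (colSum q a b) atTop
      (𝓝 ((∏' k : ℕ, (1 + a * q ^ (k + 1))) * ∏' k : ℕ, (1 + b * q ^ (k + 1)))) := by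
  obtain ⟨C, hC0, hC⟩ := exists_norm_esymmPow_le hq
  obtain ⟨B, hB0, hB⟩ := exists_norm_qProd_le hq b
  have hdiff : Tendsto (fun N => ∑' u, esymmPow q N u * (qProd q b (N - u) - qProd q b N) * a ^ u)
      atTop (𝓝 (∑' _ : ℕ, 0)) := by
    refine tendsto_tsum_of_dominated_convergence (bound := fun u => C * (B + B) * ‖a‖ ^ u)
      ((summable_geometric_of_lt_one (norm_nonneg a) ha).mul_left _) (fun u => ?_)
      (.of_forall fun N u => ?_)
    · have hsub : Tendsto (fun N => qProd q b (N - u) - qProd q b N) atTop (𝓝 0) := by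
        simpa using ((tendsto_qProd hq b).comp (tendsto_sub_atTop_nat u)).sub (tendsto_qProd hq b)
      have h0 : Tendsto (fun N => C * ‖qProd q b (N - u) - qProd q b N‖ * ‖a‖ ^ u) atTop
          (𝓝 0) := by
        simpa using (hsub.norm.const_mul C).mul_const (‖a‖ ^ u)
      refine squeeze_zero_norm (fun N => ?_) h0
      rw [norm_mul, norm_mul, norm_pow]
      gcongr
      exact hC N u
    · rw [norm_mul, norm_mul, norm_pow]
      gcongr
      · exact hC N u
      · exact (norm_sub_le _ _).trans (add_le_add (hB _) (hB _))
  rw [tsum_zero] at hdiff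
  have key := hdiff.add ((tendsto_qProd hq a).mul (tendsto_qProd hq b))
  rw [zero_add] at key
  refine key.congr fun N => ?_
  rw [tsum_eq_sum (s := range (N + 1)) fun u hu => by
      rw [esymmPow_eq_zero q (by simpa using hu)]; simp,
    ← sum_esymmPow q a N (Nat.lt_succ_self N), sum_mul, ← sum_add_distrib, colSum]
  exact sum_congr rfl fun u _ => by ring

lemma exists_sum_norm_weight_le {q a : ℂ} (hq : ‖q‖ < 1) (ha : ‖a‖ < 1) (b : ℂ) :
    ∃ C, ∀ N, ∑ l ∈ bounded (N + 1), ‖weight q a b l‖ ≤ C := by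
  have h := tendsto_colSum (q := (‖q‖ : ℂ)) (a := (‖a‖ : ℂ)) (by simpa) (by simpa) (‖b‖ : ℂ)
  obtain ⟨C, hC⟩ := h.norm.bddAbove_range
  refine ⟨C, fun N => le_trans (le_of_eq ?_) (hC ⟨N, rfl⟩)⟩
  simp only [← sum_weight_eq]
  have hw : ∀ l, weight (‖q‖ : ℂ) (‖a‖ : ℂ) (‖b‖ : ℂ) l = ((‖weight q a b l‖ : ℝ) : ℂ) := by
    intro l
    simp [weight]
  simp only [hw, ← Complex.ofReal_sum, Complex.norm_real]
  exact (Real.norm_of_nonneg (sum_nonneg fun _ _ => norm_nonneg _)).symm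

/-- `bounded (N + 1)` as a finite set of colored partitions. -/
noncomputable def boundedSubtype (N : ℕ) : Finset {l // IsColored3 l} :=
  letI := Classical.decPred IsColored3
  (bounded (N + 1)).subtype IsColored3

lemma mem_boundedSubtype (N : ℕ) (l : {l // IsColored3 l}) :
    l ∈ boundedSubtype N ↔ ∀ y ∈ l.1.head?, y.1 < N + 1 := by
  simp [boundedSubtype, mem_bounded, l.2]

lemma sum_boundedSubtype {M : Type*} [AddCommMonoid M] (f : List (ℕ × C3) → M) (N : ℕ) :
    ∑ l ∈ boundedSubtype N, f l.1 = ∑ l ∈ bounded (N + 1), f l := by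
  classical
  exact sum_subtype_of_mem f fun l hl => ((mem_bounded _ _).1 hl).1

lemma tendsto_boundedSubtype : Tendsto boundedSubtype atTop atTop := by
  refine tendsto_atTop_finset_of_monotone (fun m n h l hl => ?_) fun l => ?_
  · rw [mem_boundedSubtype] at hl ⊢
    exact fun y hy => (hl y hy).trans_le (by omega)
  · obtain ⟨_ | ⟨x, t⟩, hl⟩ := l
    · exact ⟨0, by simp [mem_boundedSubtype]⟩
    · exact ⟨x.1, by simp [mem_boundedSubtype]⟩

lemma hasSum_weight {q a : ℂ} (hq : ‖q‖ < 1) (ha : ‖a‖ < 1) (b : ℂ) :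
    HasSum (fun l : {l // IsColored3 l} => weight q a b l.1)
      ((∏' k : ℕ, (1 + a * q ^ (k + 1))) * ∏' k : ℕ, (1 + b * q ^ (k + 1))) := by
  obtain ⟨C, hC⟩ := exists_sum_norm_weight_le hq ha b
  have hs : Summable fun l : {l // IsColored3 l} => ‖weight q a b l.1‖ := by
    refine summable_of_sum_le (c := C) (fun _ => norm_nonneg _) fun s => ?_
    obtain ⟨N, hN⟩ := (tendsto_boundedSubtype.eventually_ge_atTop s).exists
    refine le_trans ?_ (hC N)
    rw [← sum_boundedSubtype (fun l => ‖weight q a b l‖)]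
    exact sum_le_sum_of_subset_of_nonneg hN fun _ _ _ => norm_nonneg _
  have h1 := hs.of_norm.hasSum
  have h2 := h1.comp tendsto_boundedSubtype
  have h3 := tendsto_colSum hq ha b
  rw [← tendsto_nhds_unique (h2.congr fun N => ?_) h3]
  · exact h1
  · exact (sum_boundedSubtype _ N).trans (sum_weight_eq q a b N)

/-- The numbers of parts with color containing `a` and `b`, and the sum of the sizes. -/
def stats (l : List (ℕ × C3)) : ℕ × ℕ × ℕ :=
  (l.countP (fun x => x.2.inA), l.countP (fun x => x.2.inB), (l.map Prod.fst).sum)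

lemma card_fiber_stats (x : ℕ × ℕ × ℕ) :
    Nat.card ((fun l : {l // IsColored3 l} => stats l.1) ⁻¹' {x}) = B3 x.1 x.2.1 x.2.2 := by
  obtain ⟨u, v, n⟩ := x
  refine Nat.card_congr ((Equiv.subtypeSubtypeEquivSubtypeInter IsColored3
    (fun l => stats l = (u, v, n))).trans (Equiv.subtypeEquivRight fun l => ?_))
  simp only [stats, Prod.mk.injEq]
  tauto

end Analysis

end AlladiGordon

/-- The identity `∑ B(u,v,n) a^u b^v q^n = (−aq;q)_∞ (−bq;q)_∞` for `|q| < 1` and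
`|a|, |b|` small. -/
theorem alladi_gordon_series (a b q : ℂ) (hq : ‖q‖ < 1) (ha : ‖a‖ < 1) (hb : ‖b‖ < 1) :
    ∑' x : ℕ × ℕ × ℕ, (B3 x.1 x.2.1 x.2.2 : ℂ) * a ^ x.1 * b ^ x.2.1 * q ^ x.2.2 =
      (∏' k : ℕ, (1 + a * q ^ (k + 1))) * ∏' k : ℕ, (1 + b * q ^ (k + 1)) := by
  have h := AlladiGordon.hasSum_weight hq ha b
  rw [← (h.tsum_fiberwise fun l => AlladiGordon.stats l.1).tsum_eq]
  refine tsum_congr fun x => ?_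
  have hc : ∀ l : ((fun l : {l // IsColored3 l} => AlladiGordon.stats l.1) ⁻¹' {x}),
      AlladiGordon.weight q a b l.1.1 = a ^ x.1 * b ^ x.2.1 * q ^ x.2.2 := by
    rintro ⟨l, rfl⟩
    rfl
  rw [tsum_congr hc, tsum_const, AlladiGordon.card_fiber_stats, nsmul_eq_mul]
  ring
end

section
/- The identity ∑_{u,v,w,n ≥ 0} B(u,v,w,n) a^u b^v c^w q^n = (−aq;q)_∞ (−bq;q)_∞ (−cq;q)_∞ holds (as formal power series, or for |q| < 1 and |a|, |b|, |c| small), where B(u,v,w,n) is the number of colored partitions of n (as defined in the context) with exactly u parts of color a, ab, or ac, exactly v parts of color b, ab, or bc, and exactly w parts of color c, ac, or bc. -/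
/-- The six colors `ab < ac < a < bc < b < c` used in the Alladi–Andrews–Gordon refinement
of Göllnitz' theorem. -/
inductive C6 : Type
  | ab | ac | a | bc | b | c
  deriving DecidableEq

/-- Index realizing the color order `ab < ac < a < bc < b < c`. -/
def C6.idx : C6 → ℕ
  | .ab => 0
  | .ac => 1
  | .a => 2
  | .bc => 3
  | .b => 4
  | .c => 5

/-- Minimal difference table `D` (row = color of `λ_i`, column = color of `λ_{i+1}`). -/
def D6 : C6 → C6 → ℕ
  | .a, .b => 2
  | .a, .c => 2
  | .a, .bc => 2
  | .a, _ => 1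
  | .b, .c => 2
  | .b, _ => 1
  | .c, _ => 1
  | .ab, _ => 2
  | .ac, .ab => 1
  | .ac, _ => 2
  | .bc, .a => 1
  | .bc, .ab => 1
  | .bc, .ac => 1
  | .bc, _ => 2

/-- Lexicographic (strict) order on colored parts: larger size, or equal size and larger color. -/
def LexGt6 (x y : ℕ × C6) : Prop :=
  y.1 < x.1 ∨ (x.1 = y.1 ∧ y.2.idx < x.2.idx)

/-- A colored partition: a lexicographically decreasing sequence of colored parts of positive
size, with no part `1_ab`, `1_ac` or `1_bc`, whose consecutive size differences are at least
given by `D6`. -/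
def IsColored6 (l : List (ℕ × C6)) : Prop :=
  (∀ x ∈ l, 0 < x.1) ∧ (1, C6.ab) ∉ l ∧ (1, C6.ac) ∉ l ∧ (1, C6.bc) ∉ l ∧
    l.Chain' (fun x y => LexGt6 x y ∧ y.1 + D6 x.2 y.2 ≤ x.1)

/-- Colors containing `a`. -/
def C6.inA : C6 → Bool
  | .a => true
  | .ab => true
  | .ac => true
  | _ => false

/-- Colors containing `b`. -/
def C6.inB : C6 → Bool
  | .b => true
  | .ab => true
  | .bc => true
  | _ => false

/-- Colors containing `c`. -/
def C6.inC : C6 → Bool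
  | .c => true
  | .ac => true
  | .bc => true
  | _ => false


/-- `B(u,v,w,n)`: the number of colored partitions of `n` with `u` parts of color `a`, `ab`
or `ac`, `v` parts of color `b`, `ab` or `bc`, and `w` parts of color `c`, `ac` or `bc`. -/
noncomputable def B6 (u v w n : ℕ) : ℕ :=
  Nat.card {l : List (ℕ × C6) // IsColored6 l ∧ (l.map Prod.fst).sum = n ∧
    l.countP (fun x => x.2.inA) = u ∧ l.countP (fun x => x.2.inB) = v ∧
    l.countP (fun x => x.2.inC) = w}

open Filter Topology

namespace C6

/-- The color with a given index. -/
def ofIdx : ℕ → C6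
  | 0 => .ab
  | 1 => .ac
  | 2 => .a
  | 3 => .bc
  | 4 => .b
  | _ => .c

/-- The minimal rank difference between a part of the given color and the next part. -/
def gap : C6 → ℕ
  | .ab => 7
  | .ac => 7
  | .a => 6
  | .bc => 7
  | .b => 6
  | .c => 6

theorem gap_pos (p : C6) : 0 < p.gap := by cases p <;> simp [gap]

end C6

/-- Position of a colored part in the lexicographic order. -/
def partRank (x : ℕ × C6) : ℕ := 6 * x.1 + x.2.idx

/-- The colored part at a given position in the lexicographic order. -/
def partAt (m : ℕ) : ℕ × C6 := (m / 6, C6.ofIdx (m % 6))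

theorem partAt_partRank (x : ℕ × C6) : partAt (partRank x) = x := by
  obtain ⟨k, p⟩ := x
  cases p <;> simp [partAt, partRank, C6.idx, Nat.mul_add_div, C6.ofIdx]

theorem partRank_partAt (m : ℕ) : partRank (partAt m) = m := by
  have h : m % 6 < 6 := Nat.mod_lt _ (by norm_num)
  have h' := Nat.div_add_mod m 6
  simp only [partRank, partAt]
  generalize m % 6 = r at *
  interval_cases r <;> simp only [C6.ofIdx, C6.idx] <;> omega

theorem partAt_add (k : ℕ) {i : ℕ} (hi : i < 6) : partAt (6 * k + i) = (k, C6.ofIdx i) := by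
  have h1 : (6 * k + i) / 6 = k := by omega
  have h2 : (6 * k + i) % 6 = i := by omega
  simp [partAt, h1, h2]

/-- The difference conditions, expressed through ranks. -/
theorem lexGt6_and_le_iff (x y : ℕ × C6) :
    (LexGt6 x y ∧ y.1 + D6 x.2 y.2 ≤ x.1) ↔ partRank y + x.2.gap ≤ partRank x := by
  obtain ⟨k, p⟩ := x
  obtain ⟨j, r⟩ := y
  cases p <;> cases r <;> simp only [LexGt6, D6, partRank, C6.idx, C6.gap] <;> omega

/-- The colored parts allowed to occur in a colored partition. -/
def Admissible (x : ℕ × C6) : Prop :=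
  0 < x.1 ∧ x ≠ (1, .ab) ∧ x ≠ (1, .ac) ∧ x ≠ (1, .bc)

instance : DecidablePred Admissible := fun x => by unfold Admissible; infer_instance

theorem isColored6_nil : IsColored6 [] := by simp [IsColored6, List.Chain']

theorem isColored6_cons (x : ℕ × C6) (l : List (ℕ × C6)) :
    IsColored6 (x :: l) ↔
      Admissible x ∧ IsColored6 l ∧ ∀ y ∈ l.head?, partRank y + x.2.gap ≤ partRank x := by
  simp only [IsColored6, Admissible, List.Chain', List.isChain_cons, lexGt6_and_le_iff,
    List.mem_cons, not_or, forall_eq_or_imp, ne_eq, @eq_comm _ x]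
  tauto

/-- The colored partitions all of whose parts have rank less than `m`. -/
def coloredBelow : ℕ → Finset (List (ℕ × C6))
  | 0 => {[]}
  | m + 1 => coloredBelow m ∪
      if Admissible (partAt m) then
        (coloredBelow (m + 1 - (partAt m).2.gap)).image (List.cons (partAt m))
      else ∅
decreasing_by
  · omega
  · have := (partAt m).2.gap_pos
    omega

theorem mem_coloredBelow {m : ℕ} {l : List (ℕ × C6)} :
    l ∈ coloredBelow m ↔ IsColored6 l ∧ ∀ x ∈ l.head?, partRank x < m := by
  induction m using Nat.strong_induction_on generalizing l with
  | _ m ih =>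
  cases m with
  | zero =>
    rw [coloredBelow]
    cases l <;> simp [isColored6_nil]
  | succ m =>
    have hg := (partAt m).2.gap_pos
    rw [coloredBelow, Finset.mem_union, ih m (by omega)]
    cases l with
    | nil => simp [isColored6_nil]
    | cons x t =>
      have hx : partRank x = m ↔ partAt m = x :=
        ⟨fun h => by rw [← h, partAt_partRank], fun h => by rw [← h, partRank_partAt]⟩
      have key : (x :: t ∈ (if Admissible (partAt m) then
          (coloredBelow (m + 1 - (partAt m).2.gap)).image (List.cons (partAt m)) else ∅)) ↔
          IsColored6 (x :: t) ∧ partRank x = m := by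
        rw [isColored6_cons, hx]
        split_ifs with h
        · simp only [Finset.mem_image, List.cons.injEq]
          constructor
          · rintro ⟨t', ht', rfl, rfl⟩
            rw [ih _ (by omega)] at ht'
            refine ⟨⟨h, ht'.1, fun y hy => ?_⟩, rfl⟩
            have := ht'.2 y hy
            rw [partRank_partAt]
            omega
          · rintro ⟨⟨_, h2, h3⟩, rfl⟩
            refine ⟨t, (ih _ (by omega)).2 ⟨h2, fun y hy => ?_⟩, rfl, rfl⟩
            have := h3 y hy
            rw [partRank_partAt] at this
            omega
        · simp only [Finset.notMem_empty, false_iff]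
          rintro ⟨⟨h1, _⟩, rfl⟩
          exact h h1
      rw [key]
      simp only [List.head?_cons, Option.mem_some_iff, forall_eq', Nat.lt_succ_iff_lt_or_eq]
      tauto

theorem coloredBelow_mono : Monotone coloredBelow := fun m n h l hl => by
  rw [mem_coloredBelow] at hl ⊢
  exact ⟨hl.1, fun x hx => (hl.2 x hx).trans_le h⟩

theorem exists_mem_coloredBelow {l : List (ℕ × C6)} (hl : IsColored6 l) :
    ∃ m, l ∈ coloredBelow m := by
  cases l with
  | nil => exact ⟨0, mem_coloredBelow.2 ⟨hl, by simp⟩⟩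
  | cons x t => exact ⟨partRank x + 1, mem_coloredBelow.2 ⟨hl, by simp⟩⟩

section Weight

variable {R : Type*} [CommRing R]

/-- The monomial attached to a list of colored parts. -/
def listWeight (a b c q : R) (l : List (ℕ × C6)) : R :=
  a ^ l.countP (fun x => x.2.inA) * b ^ l.countP (fun x => x.2.inB) *
    c ^ l.countP (fun x => x.2.inC) * q ^ (l.map Prod.fst).sum

/-- The monomial attached to a color. -/
def C6.weight (a b c : R) : C6 → R
  | .ab => a * b
  | .ac => a * c
  | .a => a
  | .bc => b * c
  | .b => b
  | .c => c

theorem listWeight_cons (a b c q : R) (x : ℕ × C6) (l : List (ℕ × C6)) :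
    listWeight a b c q (x :: l) = x.2.weight a b c * q ^ x.1 * listWeight a b c q l := by
  obtain ⟨k, p⟩ := x
  cases p <;> simp [listWeight, C6.weight, C6.inA, C6.inB, C6.inC] <;> ring

/-- Generating function of the colored partitions all of whose parts have rank less than `m`. -/
def genBelow (a b c q : R) (m : ℕ) : R := ∑ l ∈ coloredBelow m, listWeight a b c q l

theorem genBelow_zero (a b c q : R) : genBelow a b c q 0 = 1 := by
  simp [genBelow, coloredBelow, listWeight]

theorem genBelow_succ (a b c q : R) (m : ℕ) :
    genBelow a b c q (m + 1) = genBelow a b c q m +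
      if Admissible (partAt m) then (partAt m).2.weight a b c * q ^ (partAt m).1 *
        genBelow a b c q (m + 1 - (partAt m).2.gap) else 0 := by
  unfold genBelow
  rw [coloredBelow, Finset.sum_union]
  · congr 1
    split_ifs with h
    · rw [Finset.sum_image fun _ _ _ _ h => (List.cons.inj h).2, Finset.mul_sum]
      simp_rw [listWeight_cons]
    · simp
  · rw [Finset.disjoint_left]
    intro l hl hl'
    split_ifs at hl' with h
    · obtain ⟨t, -, rfl⟩ := Finset.mem_image.1 hl'
      have := (mem_coloredBelow.1 hl).2 (partAt m) (by simp)
      rw [partRank_partAt] at this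
      omega
    · simp at hl'

theorem genBelow_ab (a b c q : R) (n : ℕ) : genBelow a b c q (6 * n + 13) =
    genBelow a b c q (6 * n + 12) + a * b * q ^ (n + 2) * genBelow a b c q (6 * n + 6) := by
  have h := genBelow_succ a b c q (6 * (n + 2) + 0)
  rw [partAt_add _ (by norm_num)] at h
  simpa [C6.ofIdx, Admissible, C6.gap, C6.weight, mul_add] using h

theorem genBelow_ac (a b c q : R) (n : ℕ) : genBelow a b c q (6 * n + 14) =
    genBelow a b c q (6 * n + 13) + a * c * q ^ (n + 2) * genBelow a b c q (6 * n + 7) := by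
  have h := genBelow_succ a b c q (6 * (n + 2) + 1)
  rw [partAt_add _ (by norm_num)] at h
  simpa [C6.ofIdx, Admissible, C6.gap, C6.weight, mul_add] using h

theorem genBelow_a (a b c q : R) (n : ℕ) : genBelow a b c q (6 * n + 9) =
    genBelow a b c q (6 * n + 8) + a * q ^ (n + 1) * genBelow a b c q (6 * n + 3) := by
  have h := genBelow_succ a b c q (6 * (n + 1) + 2)
  rw [partAt_add _ (by norm_num)] at h
  simpa [C6.ofIdx, Admissible, C6.gap, C6.weight, mul_add] using h

theorem genBelow_bc (a b c q : R) (n : ℕ) : genBelow a b c q (6 * n + 16) =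
    genBelow a b c q (6 * n + 15) + b * c * q ^ (n + 2) * genBelow a b c q (6 * n + 9) := by
  have h := genBelow_succ a b c q (6 * (n + 2) + 3)
  rw [partAt_add _ (by norm_num)] at h
  simpa [C6.ofIdx, Admissible, C6.gap, C6.weight, mul_add] using h

theorem genBelow_b (a b c q : R) (n : ℕ) : genBelow a b c q (6 * n + 11) =
    genBelow a b c q (6 * n + 10) + b * q ^ (n + 1) * genBelow a b c q (6 * n + 5) := by
  have h := genBelow_succ a b c q (6 * (n + 1) + 4)
  rw [partAt_add _ (by norm_num)] at h
  simpa [C6.ofIdx, Admissible, C6.gap, C6.weight, mul_add] using h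

theorem genBelow_c (a b c q : R) (n : ℕ) : genBelow a b c q (6 * n + 12) =
    genBelow a b c q (6 * n + 11) + c * q ^ (n + 1) * genBelow a b c q (6 * n + 6) := by
  have h := genBelow_succ a b c q (6 * (n + 1) + 5)
  rw [partAt_add _ (by norm_num)] at h
  simpa [C6.ofIdx, Admissible, C6.gap, C6.weight, mul_add] using h

theorem genBelow_eq_one (a b c q : R) {m : ℕ} (hm : m ≤ 8) : genBelow a b c q m = 1 := by
  induction m with
  | zero => exact genBelow_zero a b c q
  | succ m ih =>
    rw [genBelow_succ, ih (by omega), if_neg, add_zero]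
    have hm' : m < 8 := by omega
    interval_cases m <;> decide

theorem genBelow_ten (a b c q : R) : genBelow a b c q 10 = genBelow a b c q 9 := by
  rw [genBelow_succ, if_neg (by decide), add_zero]

theorem genBelow_shift (a b c q : R) (n : ℕ) :
    genBelow a b c q (6 * n + 14) = (1 + a * q) * genBelow b c (a * q) q (6 * n + 11) ∧
    genBelow a b c q (6 * n + 9) = (1 + a * q) * genBelow b c (a * q) q (6 * n + 6) ∧
    genBelow a b c q (6 * n + 10) = (1 + a * q) * genBelow b c (a * q) q (6 * n + 7) := by
  have step : ∀ n : ℕ,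
      genBelow a b c q (6 * n + 14) = (1 + a * q) * genBelow b c (a * q) q (6 * n + 11) →
      genBelow a b c q (6 * n + 9) = (1 + a * q) * genBelow b c (a * q) q (6 * n + 6) →
      genBelow a b c q (6 * n + 15) = (1 + a * q) * genBelow b c (a * q) q (6 * n + 12) ∧
      genBelow a b c q (6 * n + 16) = (1 + a * q) * genBelow b c (a * q) q (6 * n + 13) := by
    intro n h1 h2
    have h3 : genBelow a b c q (6 * n + 15) =
        (1 + a * q) * genBelow b c (a * q) q (6 * n + 12) := by
      have e1 := genBelow_a a b c q (n + 1)
      have e2 := genBelow_c b c (a * q) q n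
      simp only [mul_add, add_assoc, Nat.reduceMul, Nat.reduceAdd] at e1 e2
      linear_combination e1 + h1 + a * q ^ (n + 2) * h2 - (1 + a * q) * e2
    have e1 := genBelow_bc a b c q n
    have e2 := genBelow_ab b c (a * q) q n
    exact ⟨h3, by linear_combination e1 + h3 + b * c * q ^ (n + 2) * h2 - (1 + a * q) * e2⟩
  have start : genBelow a b c q 9 = (1 + a * q) * genBelow b c (a * q) q 6 := by
    rw [genBelow_a a b c q 0]
    simp [genBelow_eq_one]
  have small : genBelow a b c q 14 = (1 + a * q) * genBelow b c (a * q) q 11 ∧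
      genBelow a b c q 20 = (1 + a * q) * genBelow b c (a * q) q 17 ∧
      genBelow a b c q 26 = (1 + a * q) * genBelow b c (a * q) q 23 := by
    have recs := fun x y z : R =>
      And.intro (genBelow_ab x y z q 0) <| And.intro (genBelow_ab x y z q 1) <|
      And.intro (genBelow_ab x y z q 2) <| And.intro (genBelow_ac x y z q 0) <|
      And.intro (genBelow_ac x y z q 1) <| And.intro (genBelow_ac x y z q 2) <|
      And.intro (genBelow_bc x y z q 0) <| And.intro (genBelow_bc x y z q 1) <|
      And.intro (genBelow_a x y z q 0) <| And.intro (genBelow_a x y z q 1) <|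
      And.intro (genBelow_a x y z q 2) <| And.intro (genBelow_b x y z q 0) <|
      And.intro (genBelow_b x y z q 1) <| And.intro (genBelow_b x y z q 2) <|
      And.intro (genBelow_c x y z q 0) <| And.intro (genBelow_c x y z q 1) <| genBelow_c x y z q 2
    simp only [Nat.reduceMul, Nat.reduceAdd, mul_zero, zero_add, genBelow_ten, genBelow_eq_one,
      Nat.reduceLeDiff] at recs
    simp only [recs]
    refine ⟨?_, ?_, ?_⟩ <;> ring
  induction n using Nat.strong_induction_on with
  | _ n ih =>
  have next : genBelow a b c q (6 * n + 9) = (1 + a * q) * genBelow b c (a * q) q (6 * n + 6) ∧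
      genBelow a b c q (6 * n + 10) = (1 + a * q) * genBelow b c (a * q) q (6 * n + 7) := by
    cases n with
    | zero => exact ⟨start, by simpa [genBelow_ten, genBelow_eq_one] using start⟩
    | succ n =>
      obtain ⟨h1, h2, -⟩ := ih n (by omega)
      exact step n h1 h2
  refine ⟨?_, next⟩
  match n, ih, next with
  | 0, _, _ => exact small.1
  | 1, _, _ => exact small.2.1
  | 2, _, _ => exact small.2.2
  | m + 3, ih, ⟨_, h⟩ =>
    obtain ⟨h2, -, h1⟩ := ih (m + 2) (by omega)
    obtain ⟨h4, -, h3⟩ := ih (m + 1) (by omega)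
    have f1 := genBelow_ab a b c q (m + 3)
    have f2 := genBelow_ac a b c q (m + 3)
    have f3 := genBelow_b a b c q (m + 3)
    have f4 := genBelow_c a b c q (m + 3)
    have f5 := genBelow_ab a b c q (m + 2)
    have f6 := genBelow_ac a b c q (m + 2)
    have f7 := genBelow_b a b c q (m + 2)
    have f8 := genBelow_c a b c q (m + 2)
    have f9 := genBelow_ab a b c q (m + 1)
    have f10 := genBelow_ac a b c q (m + 1)
    have f11 := genBelow_b a b c q (m + 1)
    have f12 := genBelow_c a b c q (m + 1)
    have f13 := genBelow_ab a b c q m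
    have f14 := genBelow_c a b c q m
    have g1 := genBelow_ac b c (a * q) q (m + 2)
    have g2 := genBelow_a b c (a * q) q (m + 3)
    have g3 := genBelow_bc b c (a * q) q (m + 2)
    have g4 := genBelow_b b c (a * q) q (m + 3)
    have g5 := genBelow_ac b c (a * q) q (m + 1)
    have g6 := genBelow_a b c (a * q) q (m + 2)
    have g7 := genBelow_bc b c (a * q) q (m + 1)
    have g8 := genBelow_b b c (a * q) q (m + 2)
    simp only [mul_add, add_assoc, Nat.reduceMul, Nat.reduceAdd] at h h1 h2 h3 h4 ⊢
    simp only [mul_add, add_assoc, Nat.reduceMul, Nat.reduceAdd] at f1 f2 f3 f4 f5 f6 f7 f8 f9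
    simp only [mul_add, add_assoc, Nat.reduceMul, Nat.reduceAdd] at f10 f11 f12 f13 f14
    simp only [mul_add, add_assoc, Nat.reduceMul, Nat.reduceAdd] at g1 g2 g3 g4 g5 g6 g7 g8
    simp only [f1, f2, f3, f4, f5, f6, f7, f8, f9, f10, f11, f12, f13, f14, g1, g2, g3, g4, g5, g6,
      g7, g8] at h h1 h2 h3 h4 ⊢
    linear_combination h + (a * b * q + a * c * q) * q ^ (m + 4) * h1 +
      (b + c) * q ^ (m + 4) * h2 - b * c * q ^ (2 * m + 7) * h4 +
      a ^ 2 * b * c * q ^ (2 * m + 9) * h3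

end Weight

theorem genBelow_add_six_le {q : ℝ} (hq0 : 0 ≤ q) {a b c : ℝ} (ha0 : 0 ≤ a) (ha : a ≤ 1)
    (hb0 : 0 ≤ b) (hb : b ≤ 1) (hc0 : 0 ≤ c) (hc : c ≤ 1) (k : ℕ) :
    genBelow a b c q (6 * (k + 1)) ≤ (1 + q ^ k) ^ 6 * genBelow a b c q (6 * k) := by
  have hw0 (l : List (ℕ × C6)) : 0 ≤ listWeight a b c q l := by unfold listWeight; positivity
  have hmono : Monotone (genBelow a b c q) := fun m n h =>
    Finset.sum_le_sum_of_subset_of_nonneg (coloredBelow_mono h) fun l _ _ => hw0 l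
  have hpos (m : ℕ) : 0 ≤ genBelow a b c q m := Finset.sum_nonneg fun l _ => hw0 l
  have hcol (p : C6) : p.weight a b c ≤ 1 := by
    cases p <;> simp only [C6.weight] <;> first | assumption | exact mul_le_one₀ ‹_› ‹_› ‹_›
  have hstep {i : ℕ} (hi : i < 6) :
      genBelow a b c q (6 * k + i + 1) ≤ (1 + q ^ k) * genBelow a b c q (6 * k + i) := by
    rw [genBelow_succ, partAt_add k hi, add_mul, one_mul]
    refine add_le_add_right ?_ _
    split_ifs with h
    · refine mul_le_mul (mul_le_of_le_one_left (by positivity) (hcol _)) (hmono ?_) (hpos _)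
        (by positivity)
      have := (C6.ofIdx i).gap_pos
      simp only
      omega
    · exact mul_nonneg (by positivity) (hpos _)
  have hiter {i : ℕ} (hi : i ≤ 6) :
      genBelow a b c q (6 * k + i) ≤ (1 + q ^ k) ^ i * genBelow a b c q (6 * k) := by
    induction i with
    | zero => simp
    | succ i ih =>
      calc genBelow a b c q (6 * k + i + 1) ≤ (1 + q ^ k) * genBelow a b c q (6 * k + i) :=
            hstep (by omega)
        _ ≤ (1 + q ^ k) * ((1 + q ^ k) ^ i * genBelow a b c q (6 * k)) := by
            gcongr
            exact ih (by omega)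
        _ = _ := by ring
  exact hiter le_rfl

theorem genBelow_le_exp {q : ℝ} (hq0 : 0 ≤ q) (hq : q < 1) {a b c : ℝ} (ha0 : 0 ≤ a)
    (ha : a ≤ 1) (hb0 : 0 ≤ b) (hb : b ≤ 1) (hc0 : 0 ≤ c) (hc : c ≤ 1) (k : ℕ) :
    genBelow a b c q (6 * k) ≤ Real.exp (6 * (1 - q)⁻¹) := by
  have h (k : ℕ) : genBelow a b c q (6 * k) ≤ Real.exp (6 * ∑ j ∈ Finset.range k, q ^ j) := by
    induction k with
    | zero => simp [genBelow_zero]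
    | succ k ih =>
      refine (genBelow_add_six_le hq0 ha0 ha hb0 hb hc0 hc k).trans ?_
      rw [Finset.sum_range_succ, mul_add, Real.exp_add, mul_comm]
      refine mul_le_mul ih ?_ (by positivity) (by positivity)
      calc (1 + q ^ k) ^ 6 ≤ Real.exp (q ^ k) ^ 6 := by
            gcongr
            rw [add_comm]
            exact Real.add_one_le_exp _
        _ = Real.exp (6 * q ^ k) := by rw [← Real.exp_nat_mul]; norm_num
  refine (h k).trans ?_
  gcongr
  rw [← tsum_geometric_of_lt_one hq0 hq]
  exact (summable_geometric_of_lt_one hq0 hq).sum_le_tsum _ fun _ _ => by positivity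

/-- The finite sets of colored partitions with parts of rank less than `m`. -/
noncomputable def coloredSubtypeBelow (m : ℕ) : Finset {l // IsColored6 l} :=
  haveI := Classical.decPred IsColored6
  (coloredBelow m).subtype IsColored6

theorem sum_coloredSubtypeBelow {R : Type*} [CommRing R] (a b c q : R) (m : ℕ) :
    ∑ l ∈ coloredSubtypeBelow m, listWeight a b c q l = genBelow a b c q m := by
  classical
  unfold coloredSubtypeBelow genBelow
  exact Finset.sum_subtype_of_mem (listWeight a b c q) fun l hl => (mem_coloredBelow.1 hl).1

theorem tendsto_coloredSubtypeBelow : Tendsto coloredSubtypeBelow atTop atTop := by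
  refine tendsto_atTop_finset_of_monotone (fun m n h l hl => ?_) fun l => ?_
  · simp only [coloredSubtypeBelow, Finset.mem_subtype] at hl ⊢
    exact coloredBelow_mono h hl
  · obtain ⟨m, hm⟩ := exists_mem_coloredBelow l.2
    exact ⟨m, by simpa [coloredSubtypeBelow] using hm⟩

theorem norm_listWeight (a b c q : ℂ) (l : List (ℕ × C6)) :
    ‖listWeight a b c q l‖ = listWeight ‖a‖ ‖b‖ ‖c‖ ‖q‖ l := by
  simp [listWeight]

section Analytic

variable {a b c q : ℂ}

theorem summable_norm_listWeight (hq : ‖q‖ < 1) (ha : ‖a‖ ≤ 1) (hb : ‖b‖ ≤ 1) (hc : ‖c‖ ≤ 1) :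
    Summable fun l : {l // IsColored6 l} => ‖listWeight a b c q l‖ := by
  refine summable_of_sum_le (c := Real.exp (6 * (1 - ‖q‖)⁻¹)) (fun _ => norm_nonneg _) fun s => ?_
  obtain ⟨m, hm⟩ := (tendsto_coloredSubtypeBelow.eventually_ge_atTop s).exists_forall_of_atTop
  calc ∑ l ∈ s, ‖listWeight a b c q l‖
      ≤ ∑ l ∈ coloredSubtypeBelow (6 * m), ‖listWeight a b c q l‖ :=
        Finset.sum_le_sum_of_subset_of_nonneg (hm _ (by omega)) fun _ _ _ => norm_nonneg _
    _ = genBelow ‖a‖ ‖b‖ ‖c‖ ‖q‖ (6 * m) := by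
        simp_rw [norm_listWeight]
        exact sum_coloredSubtypeBelow _ _ _ _ _
    _ ≤ _ := genBelow_le_exp (norm_nonneg _) hq (norm_nonneg _) ha (norm_nonneg _) hb
        (norm_nonneg _) hc m

/-- Generating function of all colored partitions. -/
noncomputable def genColored (a b c q : ℂ) : ℂ :=
  ∑' l : {l // IsColored6 l}, listWeight a b c q l

theorem tendsto_genBelow (hq : ‖q‖ < 1) (ha : ‖a‖ ≤ 1) (hb : ‖b‖ ≤ 1) (hc : ‖c‖ ≤ 1) :
    Tendsto (genBelow a b c q) atTop (𝓝 (genColored a b c q)) := by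
  have h := (summable_norm_listWeight hq ha hb hc).of_norm.hasSum.comp tendsto_coloredSubtypeBelow
  refine h.congr fun m => ?_
  exact sum_coloredSubtypeBelow a b c q m

theorem norm_mul_le_one_of_le {x y : ℂ} (hx : ‖x‖ ≤ 1) (hy : ‖y‖ ≤ 1) : ‖x * y‖ ≤ 1 := by
  rw [norm_mul]
  exact mul_le_one₀ hx (norm_nonneg _) hy

theorem genColored_shift (hq : ‖q‖ < 1) (ha : ‖a‖ ≤ 1) (hb : ‖b‖ ≤ 1) (hc : ‖c‖ ≤ 1) :
    genColored a b c q = (1 + a * q) * genColored b c (a * q) q := by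
  have hn (i : ℕ) : Tendsto (fun n : ℕ => 6 * n + i) atTop atTop :=
    tendsto_atTop_mono (fun n => (by omega : n ≤ 6 * n + i)) tendsto_id
  have h1 := (tendsto_genBelow hq ha hb hc).comp (hn 9)
  have h2 := ((tendsto_genBelow hq hb hc (norm_mul_le_one_of_le ha hq.le)).comp (hn 6)).const_mul
    (1 + a * q)
  refine tendsto_nhds_unique h1 (h2.congr fun n => ?_)
  exact (genBelow_shift a b c q n).2.1.symm

theorem genColored_mul_q (hq : ‖q‖ < 1) (ha : ‖a‖ ≤ 1) (hb : ‖b‖ ≤ 1) (hc : ‖c‖ ≤ 1) :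
    genColored a b c q = (1 + a * q) * (1 + b * q) * (1 + c * q) *
      genColored (a * q) (b * q) (c * q) q := by
  have ha' := norm_mul_le_one_of_le ha hq.le
  have hb' := norm_mul_le_one_of_le hb hq.le
  rw [genColored_shift hq ha hb hc, genColored_shift hq hb hc ha', genColored_shift hq hc ha' hb']
  ring

theorem genColored_eq_prod_mul (hq : ‖q‖ < 1) (ha : ‖a‖ ≤ 1) (hb : ‖b‖ ≤ 1) (hc : ‖c‖ ≤ 1)
    (n : ℕ) : genColored a b c q =
      (∏ k ∈ Finset.range n, (1 + a * q ^ (k + 1))) *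
        (∏ k ∈ Finset.range n, (1 + b * q ^ (k + 1))) *
        (∏ k ∈ Finset.range n, (1 + c * q ^ (k + 1))) *
          genColored (a * q ^ n) (b * q ^ n) (c * q ^ n) q := by
  induction n with
  | zero => simp
  | succ n ih =>
    have hqn : ‖q ^ n‖ ≤ 1 := by
      rw [norm_pow]
      exact pow_le_one₀ (norm_nonneg _) hq.le
    rw [ih, genColored_mul_q hq (norm_mul_le_one_of_le ha hqn) (norm_mul_le_one_of_le hb hqn)
      (norm_mul_le_one_of_le hc hqn)]
    simp only [Finset.prod_range_succ, pow_succ, mul_assoc]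
    ring

theorem listWeight_zero (q : ℂ) (l : List (ℕ × C6)) :
    listWeight 0 0 0 q l = if l = [] then 1 else 0 := by
  cases l with
  | nil => simp [listWeight]
  | cons x l =>
    rw [listWeight_cons]
    cases x.2 <;> simp [C6.weight]

theorem tendsto_genColored_pow (hq : ‖q‖ < 1) (ha : ‖a‖ ≤ 1) (hb : ‖b‖ ≤ 1) (hc : ‖c‖ ≤ 1) :
    Tendsto (fun n : ℕ => genColored (a * q ^ n) (b * q ^ n) (c * q ^ n) q) atTop (𝓝 1) := by
  have h0 (x : ℂ) : Tendsto (fun n : ℕ => x * q ^ n) atTop (𝓝 0) := by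
    simpa using (tendsto_pow_atTop_nhds_zero_of_norm_lt_one hq).const_mul x
  have hle (x : ℂ) (n : ℕ) : ‖x * q ^ n‖ ≤ ‖x‖ := by
    rw [norm_mul, norm_pow]
    exact mul_le_of_le_one_right (norm_nonneg _) (pow_le_one₀ (norm_nonneg _) hq.le)
  have key := tendsto_tsum_of_dominated_convergence (𝓕 := atTop)
    (f := fun (n : ℕ) (l : {l // IsColored6 l}) =>
      listWeight (a * q ^ n) (b * q ^ n) (c * q ^ n) q l)
    (g := fun l : {l // IsColored6 l} => listWeight 0 0 0 q l)
    (summable_norm_listWeight hq ha hb hc) (fun l => ?_) (Eventually.of_forall fun n l => ?_)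
  · have h1 : ∑' l : {l // IsColored6 l}, listWeight 0 0 0 q l = 1 := by
      rw [tsum_eq_single ⟨[], isColored6_nil⟩]
      · simp [listWeight_zero]
      · intro l hl
        rw [listWeight_zero, if_neg fun h => hl (Subtype.ext h)]
    rwa [h1] at key
  · exact ((((h0 a).pow _).mul ((h0 b).pow _)).mul ((h0 c).pow _)).mul_const _
  · rw [norm_listWeight, norm_listWeight]
    unfold listWeight
    gcongr <;> exact hle _ _

theorem tendsto_prod_one_add_mul_pow (hq : ‖q‖ < 1) (x : ℂ) :
    Tendsto (fun n => ∏ k ∈ Finset.range n, (1 + x * q ^ (k + 1))) atTop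
      (𝓝 (∏' k : ℕ, (1 + x * q ^ (k + 1)))) := by
  refine (multipliable_one_add_of_summable ?_).hasProd.tendsto_prod_nat
  simp only [norm_mul, norm_pow]
  exact ((summable_nat_add_iff 1).2
    (summable_geometric_of_lt_one (norm_nonneg q) hq)).mul_left _

theorem genColored_eq_tprod (hq : ‖q‖ < 1) (ha : ‖a‖ ≤ 1) (hb : ‖b‖ ≤ 1) (hc : ‖c‖ ≤ 1) :
    genColored a b c q = (∏' k : ℕ, (1 + a * q ^ (k + 1))) *
      (∏' k : ℕ, (1 + b * q ^ (k + 1))) * ∏' k : ℕ, (1 + c * q ^ (k + 1)) := by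
  have h := (((tendsto_prod_one_add_mul_pow hq a).mul (tendsto_prod_one_add_mul_pow hq b)).mul
    (tendsto_prod_one_add_mul_pow hq c)).mul (tendsto_genColored_pow hq ha hb hc)
  rw [mul_one] at h
  exact tendsto_nhds_unique
    (tendsto_const_nhds.congr fun n => genColored_eq_prod_mul hq ha hb hc n) h

/-- The statistics `(u, v, w, n)` of a list of colored parts. -/
def colorStats (l : List (ℕ × C6)) : ℕ × ℕ × ℕ × ℕ :=
  (l.countP fun x => x.2.inA, l.countP fun x => x.2.inB, l.countP fun x => x.2.inC,
    (l.map Prod.fst).sum)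

theorem card_fiber_colorStats (x : ℕ × ℕ × ℕ × ℕ) :
    Nat.card ((fun l : {l // IsColored6 l} => colorStats l) ⁻¹' {x}) =
      B6 x.1 x.2.1 x.2.2.1 x.2.2.2 := by
  obtain ⟨u, v, w, n⟩ := x
  refine Nat.card_congr ((Equiv.subtypeSubtypeEquivSubtypeInter IsColored6
    fun l => colorStats l = (u, v, w, n)).trans (Equiv.subtypeEquivRight fun l => ?_))
  simp only [colorStats, Prod.mk.injEq]
  tauto

theorem tsum_B6_eq_genColored (hq : ‖q‖ < 1) (ha : ‖a‖ ≤ 1) (hb : ‖b‖ ≤ 1) (hc : ‖c‖ ≤ 1) :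
    ∑' x : ℕ × ℕ × ℕ × ℕ,
        (B6 x.1 x.2.1 x.2.2.1 x.2.2.2 : ℂ) * a ^ x.1 * b ^ x.2.1 * c ^ x.2.2.1 * q ^ x.2.2.2 =
      genColored a b c q := by
  have h := (summable_norm_listWeight hq ha hb hc).of_norm.hasSum.tsum_fiberwise
    fun l : {l // IsColored6 l} => colorStats l
  rw [genColored, ← h.tsum_eq]
  refine tsum_congr fun x => ?_
  have hx (l : (fun l : {l // IsColored6 l} => colorStats l) ⁻¹' {x}) :
      listWeight a b c q (l : {l // IsColored6 l}) =
        a ^ x.1 * b ^ x.2.1 * c ^ x.2.2.1 * q ^ x.2.2.2 := by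
    obtain ⟨l, rfl⟩ := l
    rfl
  rw [tsum_congr hx, tsum_const, card_fiber_colorStats, nsmul_eq_mul]
  ring

end Analytic

/-- The identity `∑ B(u,v,w,n) a^u b^v c^w q^n = (−aq;q)_∞ (−bq;q)_∞ (−cq;q)_∞`
for `|q| < 1` and `|a|, |b|, |c|` small. -/
theorem alladi_andrews_gordon_series (a b c q : ℂ) (hq : ‖q‖ < 1)
    (ha : ‖a‖ < 1) (hb : ‖b‖ < 1) (hc : ‖c‖ < 1) :
    ∑' x : ℕ × ℕ × ℕ × ℕ,
        (B6 x.1 x.2.1 x.2.2.1 x.2.2.2 : ℂ) * a ^ x.1 * b ^ x.2.1 * c ^ x.2.2.1 * q ^ x.2.2.2 =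
      (∏' k : ℕ, (1 + a * q ^ (k + 1))) * (∏' k : ℕ, (1 + b * q ^ (k + 1))) *
        ∏' k : ℕ, (1 + c * q ^ (k + 1)) := by
  rw [tsum_B6_eq_genColored hq ha.le hb.le hc.le, genColored_eq_tprod hq ha.le hb.le hc.le]
end

section
/- The identity ∑_{u,v,w,t,n ≥ 0} B(u,v,w,t,n) a^u b^v c^w d^t q^n = (−aq;q)_∞ (−bq;q)_∞ (−cq;q)_∞ (−dq;q)_∞ holds (as formal power series, or for |q| < 1 and |a|, |b|, |c|, |d| small), where B(u,v,w,t,n) is the number of AAB quaternary partitions of n (as defined in the context) with exactly u parts whose color contains a, exactly v parts whose color contains b, exactly w parts whose color contains c, and exactly t parts whose color contains d. -/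
/-- The four primary and six secondary colors, totally ordered by
`ab < ac < ad < a < bc < bd < b < cd < c < d`. -/
inductive C10 : Type
  | ab | ac | ad | a | bc | bd | b | cd | c | d
  deriving DecidableEq

/-- Index realizing the color order `ab < ac < ad < a < bc < bd < b < cd < c < d`. -/
def C10.idx : C10 → ℕ
  | .ab => 0
  | .ac => 1
  | .ad => 2
  | .a => 3
  | .bc => 4
  | .bd => 5
  | .b => 6
  | .cd => 7
  | .c => 8
  | .d => 9

/-- Whether a color is primary. -/
def C10.primary : C10 → Bool
  | .a => true
  | .b => true
  | .c => true
  | .d => true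
  | _ => false

/-- The lexicographic order `≻` on colored parts: `k_p ≻ l_q ↔ k − l ≥ χ(p ≤ q)`. -/
def Succ (x y : ℕ × C10) : Prop :=
  y.1 + (if x.2.idx ≤ y.2.idx then 1 else 0) ≤ x.1

/-- A colored part belongs to `P ∪ S`: positive size, and size at least 2 if the color is
secondary. -/
def InPS (x : ℕ × C10) : Prop :=
  0 < x.1 ∧ (x.2.primary = false → 2 ≤ x.1)

/-- Colors containing `a`. -/
def C10.hasA : C10 → Bool
  | .a => true
  | .ab => true
  | .ac => true
  | .ad => true
  | _ => false

/-- Colors containing `b`. -/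
def C10.hasB : C10 → Bool
  | .b => true
  | .ab => true
  | .bc => true
  | .bd => true
  | _ => false

/-- Colors containing `c`. -/
def C10.hasC : C10 → Bool
  | .c => true
  | .ac => true
  | .bc => true
  | .cd => true
  | _ => false

/-- Colors containing `d`. -/
def C10.hasD : C10 → Bool
  | .d => true
  | .ad => true
  | .bd => true
  | .cd => true
  | _ => false

/-- The relation `▷`: `k_p ▷ l_q` iff `k − l ≥ 1 + χ(p < q)` when `p` or `q` is primary, and
`k − l ≥ 1 + χ(p ≤ q)` when `p` and `q` are both secondary. -/
def Rhd (x y : ℕ × C10) : Prop :=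
  if x.2.primary ∨ y.2.primary then
    y.1 + 1 + (if x.2.idx < y.2.idx then 1 else 0) ≤ x.1
  else
    y.1 + 1 + (if x.2.idx ≤ y.2.idx then 1 else 0) ≤ x.1

/-- An Alladi–Andrews–Berkovich quaternary partition, encoded as the list `l` of its primary
and secondary parts in decreasing lexicographic order together with the decreasing list `Q` of
sizes of its parts of quaternary color `abcd`: secondary parts have size at least 2,
consecutive primary/secondary parts satisfy `▷`, quaternary parts pairwise differ by at
least 4, and every quaternary part is at least `4 + 2τ − χ(1_a is a part)` where `τ` is the
number of primary and secondary parts. -/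
def IsAAB (l : List (ℕ × C10)) (Q : List ℕ) : Prop :=
  (∀ x ∈ l, InPS x) ∧ l.Chain' Rhd ∧ Q.Chain' (fun x y => y + 4 ≤ x) ∧
    ∀ K ∈ Q, 4 + 2 * l.length - (if (1, C10.a) ∈ l then 1 else 0) ≤ K

/-- `B(u,v,w,t,n)`: the number of AAB quaternary partitions of `n` with exactly `u`, `v`,
`w`, `t` parts whose color contains `a`, `b`, `c`, `d` respectively (a part of color `abcd`
contributes to all four counts). -/
noncomputable def Baab (u v w t n : ℕ) : ℕ :=
  Nat.card {p : List (ℕ × C10) × List ℕ // IsAAB p.1 p.2 ∧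
    (p.1.map Prod.fst).sum + p.2.sum = n ∧
    p.1.countP (fun x => x.2.hasA) + p.2.length = u ∧
    p.1.countP (fun x => x.2.hasB) + p.2.length = v ∧
    p.1.countP (fun x => x.2.hasC) + p.2.length = w ∧
    p.1.countP (fun x => x.2.hasD) + p.2.length = t}

namespace AAB

open Filter Topology PowerSeries

/-- Lists of `τ` natural numbers, all at least `s`, in which every entry is at least the `gap`
of each later entry. -/
def gapChains (gap : ℕ → ℕ) (τ s : ℕ) : Set (List ℕ) :=
  {l | l.length = τ ∧ l.Pairwise (fun x y => gap y ≤ x) ∧ ∀ x ∈ l, s ≤ x}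

theorem summable_norm_prod_of_pairwise_gt (w : ℕ → ℂ) (hw : Summable fun s => ‖w s‖) :
    Summable fun l : {l : List ℕ // l.Pairwise (· > ·)} => ‖(l.1.map w).prod‖ := by
  have h1 := summable_finsetProd_of_summable_nonneg (fun i => norm_nonneg (w i)) hw
  have hinj : Function.Injective
      (fun l : {l : List ℕ // l.Pairwise (· > ·)} => l.1.toFinset) := by
    rintro ⟨l, hl⟩ ⟨l', hl'⟩ h
    have hp := List.perm_of_nodup_nodup_toFinset_eq (hl.imp ne_of_gt) (hl'.imp ne_of_gt) h
    exact Subtype.ext (List.Perm.eq_of_pairwise (le := (· > ·))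
    (fun a b _ _ (h1 : a > b) (h2 : b > a) => (lt_asymm h1 h2).elim) hl hl' hp)
  refine (h1.comp_injective hinj).congr fun l => ?_
  have hl : l.1.Nodup := l.2.imp ne_of_gt
  rw [Function.comp_apply, List.prod_toFinset _ hl]
  induction l.1 with
  | nil => simp
  | cons x t ih => simp [ih]

theorem gapChains_pairwise_gt {gap : ℕ → ℕ} (hgap : ∀ s, s < gap s) {τ s : ℕ} {l : List ℕ}
    (hl : l ∈ gapChains gap τ s) : l.Pairwise (· > ·) :=
  hl.2.1.imp fun {a b} (h : gap b ≤ a) => lt_of_lt_of_le (hgap b) h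

theorem summable_norm_indicator_of_pairwise_gt (w : ℕ → ℂ) (hw : Summable fun s => ‖w s‖)
    {S : Set (List ℕ)} (hS : ∀ l ∈ S, l.Pairwise (· > ·)) :
    Summable fun l : List ℕ => ‖S.indicator (fun l : List ℕ => (l.map w).prod) l‖ := by
  have h := (summable_subtype_iff_indicator (s := {l : List ℕ | l.Pairwise (· > ·)})
    (f := fun l : List ℕ => ‖(l.map w).prod‖)).1 (summable_norm_prod_of_pairwise_gt w hw)
  refine Summable.of_nonneg_of_le (fun _ => norm_nonneg _) (fun l => ?_) h
  by_cases hl : l ∈ S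
  · have : l ∈ {l : List ℕ | l.Pairwise (· > ·)} := hS l hl
    rw [Set.indicator_of_mem hl]
    exact (Set.indicator_of_mem (f := fun l : List ℕ => ‖(l.map w).prod‖) this).ge
  · rw [Set.indicator_of_notMem hl, norm_zero]
    exact Set.indicator_nonneg (fun _ _ => norm_nonneg _) _

theorem summable_norm_indicator_gapChains (w : ℕ → ℂ) (hw : Summable fun s => ‖w s‖)
    {gap : ℕ → ℕ} (hgap : ∀ s, s < gap s) (τ s : ℕ) :
    Summable fun l : List ℕ =>
      ‖(gapChains gap τ s).indicator (fun l : List ℕ => (l.map w).prod) l‖ :=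
  summable_norm_indicator_of_pairwise_gt w hw fun _ => gapChains_pairwise_gt hgap

theorem gapChains_succ {gap : ℕ → ℕ} (hgap : ∀ s, s < gap s) (τ s : ℕ) :
    gapChains gap (τ + 1) s =
      gapChains gap (τ + 1) (s + 1) ∪ (fun l => l ++ [s]) '' gapChains gap τ (gap s) := by
  ext l
  constructor
  · rintro ⟨h1, h2, h3⟩
    rcases List.eq_nil_or_concat l with rfl | ⟨l', y, rfl⟩
    · simp at h1
    rw [List.concat_eq_append] at *
    have hp := List.pairwise_append.1 h2
    have hy : s ≤ y := h3 y (by simp)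
    rcases hy.eq_or_lt with rfl | hy
    · refine Or.inr ⟨l', ⟨by simpa using h1, hp.1, fun x hx => hp.2.2 x hx s (by simp)⟩, rfl⟩
    · refine Or.inl ⟨h1, h2, fun x hx => ?_⟩
      rcases List.mem_append.1 hx with hx | hx
      · have h4 := hp.2.2 x hx y (by simp)
        have := hgap y
        omega
      · have : x = y := by simpa using hx
        omega
  · rintro (⟨h1, h2, h3⟩ | ⟨l', ⟨h1, h2, h3⟩, rfl⟩)
    · exact ⟨h1, h2, fun x hx => (Nat.le_succ s).trans (h3 x hx)⟩
    · refine ⟨by simp [h1], List.pairwise_append.2 ⟨h2, by simp, fun x hx y hy => ?_⟩,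
        fun x hx => ?_⟩
      · rw [List.mem_singleton.1 hy]
        exact h3 x hx
      · rcases List.mem_append.1 hx with hx | hx
        · exact (hgap s).le.trans (h3 x hx)
        · exact (List.mem_singleton.1 hx).ge

theorem disjoint_gapChains_succ (gap : ℕ → ℕ) (τ s : ℕ) :
    Disjoint (gapChains gap (τ + 1) (s + 1))
      ((fun l => l ++ [s]) '' gapChains gap τ (gap s)) := by
  rw [Set.disjoint_left]
  rintro _ h ⟨l, _, rfl⟩
  have := h.2.2 s (by simp)
  omega

/-- A closed form for the weighted count of gap chains satisfying the recurrence obtained by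
splitting off the smallest entry is correct. -/
theorem hasSum_gapChains (w : ℕ → ℂ) (hw : Summable fun s => ‖w s‖)
    {gap : ℕ → ℕ} (hgap : ∀ s, s < gap s) (C : ℕ → ℕ → ℂ) (C_zero : ∀ s, C 0 s = 1)
    (C_succ : ∀ τ s, C (τ + 1) s = C (τ + 1) (s + 1) + w s * C τ (gap s))
    (C_lim : ∀ τ, Tendsto (C (τ + 1)) atTop (𝓝 0)) (τ s : ℕ) :
    HasSum ((gapChains gap τ s).indicator fun l => (l.map w).prod) (C τ s) := by
  induction τ generalizing s with
  | zero =>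
    have h0 : gapChains gap 0 s = {[]} := by
      ext l
      constructor
      · rintro ⟨h, -⟩
        exact List.length_eq_zero_iff.1 h
      · rintro rfl
        exact ⟨rfl, List.Pairwise.nil, by simp⟩
    rw [h0, C_zero]
    convert hasSum_ite_eq ([] : List ℕ) (1 : ℂ) using 2 with l
    by_cases hl : l = []
    · simp [hl]
    · simp [hl]
  | succ τ ih =>
    set W : List ℕ → ℂ := fun l => (l.map w).prod with hW
    have hsum : ∀ s, Summable ((gapChains gap (τ + 1) s).indicator W) := fun s =>
      (summable_norm_indicator_gapChains w hw hgap (τ + 1) s).of_norm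
    set A : ℕ → ℂ := fun s => ∑' l, (gapChains gap (τ + 1) s).indicator W l with hA
    have himg : ∀ s, HasSum (((fun l => l ++ [s]) '' gapChains gap τ (gap s)).indicator W)
        (w s * C τ (gap s)) := by
      intro s
      have hinj : Function.Injective (fun l : List ℕ => l ++ [s]) :=
        fun l l' h => List.append_cancel_right h
      rw [← hinj.hasSum_iff]
      · refine (congrArg (HasSum · _) (funext fun l => ?_)).mpr ((ih (gap s)).mul_left (w s))
        by_cases hl : l ∈ gapChains gap τ (gap s)
        · rw [Function.comp_apply, Set.indicator_of_mem (Set.mem_image_of_mem _ hl),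
            Set.indicator_of_mem hl, hW]
          simp [mul_comm]
        · rw [Function.comp_apply, Set.indicator_of_notMem, Set.indicator_of_notMem hl, mul_zero]
          rintro ⟨l', hl', h⟩
          exact hl (hinj h ▸ hl')
      · intro l hl
        refine Set.indicator_of_notMem (fun h => hl ?_) _
        exact Set.image_subset_range _ _ h
    have hstep : ∀ s, A s = A (s + 1) + w s * C τ (gap s) := by
      intro s
      rw [hA]
      simp only
      rw [gapChains_succ hgap τ s, Set.indicator_union_of_disjoint (disjoint_gapChains_succ gap τ s),
        ← (himg s).tsum_eq, ← (hsum (s + 1)).tsum_add (himg s).summable]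
    have hconst : ∀ k, A s - C (τ + 1) s = A (s + k) - C (τ + 1) (s + k) := by
      intro k
      induction k with
      | zero => rfl
      | succ k ihk => rw [ihk, hstep (s + k), C_succ τ (s + k), ← add_assoc]; ring
    have hAlim : Tendsto A atTop (𝓝 0) := by
      have h := tendsto_tsum_of_dominated_convergence (𝓕 := atTop)
        (f := fun s l => (gapChains gap (τ + 1) s).indicator W l) (g := fun _ => 0)
        (summable_norm_indicator_gapChains w hw hgap (τ + 1) 0) ?_ ?_
      · simpa using h
      · intro l
        refine tendsto_const_nhds.congr' ?_
        filter_upwards [eventually_gt_atTop (l.headD 0)] with n hn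
        rw [Set.indicator_of_notMem]
        rintro ⟨h1, -, h3⟩
        cases l with
        | nil => simp at h1
        | cons x t =>
          have := h3 x (by simp)
          simp at hn
          omega
      · refine Eventually.of_forall fun n l => ?_
        have hsub : gapChains gap (τ + 1) n ⊆ gapChains gap (τ + 1) 0 :=
          fun l hl => ⟨hl.1, hl.2.1, fun _ _ => Nat.zero_le _⟩
        rw [norm_indicator_eq_indicator_norm, norm_indicator_eq_indicator_norm]
        exact Set.indicator_le_indicator_of_subset hsub (fun _ => norm_nonneg _) l
    have hlim : Tendsto (fun k => A (s + k) - C (τ + 1) (s + k)) atTop (𝓝 (0 - 0)) := by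
      have hs : Tendsto (fun k => s + k) atTop atTop := tendsto_atTop_mono
        (fun k => Nat.le_add_left k s) tendsto_id
      exact (hAlim.comp hs).sub ((C_lim τ).comp hs)
    have h0 : A s - C (τ + 1) s = 0 - 0 :=
      tendsto_nhds_unique (tendsto_const_nhds.congr fun k => hconst k) hlim
    have h1 : A s = C (τ + 1) s := by
      rw [sub_zero] at h0
      exact sub_eq_zero.1 h0
    rw [← h1]
    exact (hsum s).hasSum

/-- The `q`-factorial `(q;q)_n`. -/
noncomputable def qPoch (q : ℂ) (n : ℕ) : ℂ := ∏ k ∈ Finset.range n, (1 - q ^ (k + 1))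

theorem qPoch_succ (q : ℂ) (n : ℕ) : qPoch q (n + 1) = qPoch q n * (1 - q ^ (n + 1)) :=
  Finset.prod_range_succ _ _

theorem one_sub_norm_le (q : ℂ) (hq : ‖q‖ < 1) (k : ℕ) : 1 - ‖q‖ ≤ ‖1 - q ^ (k + 1)‖ := by
  have h1 : ‖q ^ (k + 1)‖ ≤ ‖q‖ := by
    rw [norm_pow]
    exact pow_le_of_le_one (norm_nonneg _) hq.le (Nat.succ_ne_zero k)
  have h2 := norm_sub_norm_le (1 : ℂ) (q ^ (k + 1))
  rw [norm_one] at h2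
  linarith

theorem one_sub_pow_ne_zero (q : ℂ) (hq : ‖q‖ < 1) (k : ℕ) : 1 - q ^ (k + 1) ≠ 0 := by
  have := one_sub_norm_le q hq k
  exact norm_pos_iff.1 (by linarith)

theorem qPoch_ne_zero (q : ℂ) (hq : ‖q‖ < 1) (n : ℕ) : qPoch q n ≠ 0 :=
  Finset.prod_ne_zero_iff.2 fun k _ => one_sub_pow_ne_zero q hq k

theorem norm_inv_qPoch_le (q : ℂ) (hq : ‖q‖ < 1) (n : ℕ) :
    ‖(qPoch q n)⁻¹‖ ≤ (1 - ‖q‖)⁻¹ ^ n := by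
  have h0 : 0 < 1 - ‖q‖ := by linarith
  rw [norm_inv, inv_pow]
  refine inv_anti₀ (pow_pos h0 n) ?_
  rw [qPoch, norm_prod, ← Finset.card_range n, ← Finset.prod_const, Finset.card_range]
  exact Finset.prod_le_prod (fun _ _ => h0.le) fun k _ => one_sub_norm_le q hq k

/-- The expansion of `1 / (z; q)_∞` in powers of `z`. -/
noncomputable def invPochSeries (q : ℂ) : ℂ⟦X⟧ := mk fun n => (qPoch q n)⁻¹

/-- The expansion of `(-z; q)_∞` in powers of `z`. -/
noncomputable def pochSeries (q : ℂ) : ℂ⟦X⟧ := mk fun n => q ^ n.choose 2 * (qPoch q n)⁻¹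

/-- The expansion of `1 / (y z²; q)_∞` in powers of `z`. -/
noncomputable def invPochSqSeries (q y : ℂ) : ℂ⟦X⟧ :=
  mk fun n => if Even n then y ^ (n / 2) * (qPoch q (n / 2))⁻¹ else 0

theorem coeff_succ_one_add_C_mul_X_mul (x : ℂ) (f : ℂ⟦X⟧) (n : ℕ) :
    coeff (n + 1) ((1 + C x * X) * f) = coeff (n + 1) f + x * coeff n f := by
  rw [add_mul, one_mul, mul_assoc, map_add, coeff_C_mul, coeff_succ_X_mul]

theorem rescale_invPochSeries (q : ℂ) (hq : ‖q‖ < 1) (x : ℂ) :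
    rescale (x * q) (invPochSeries q) = (1 - C x * X) * rescale x (invPochSeries q) := by
  have h : (1 - C x * X : ℂ⟦X⟧) = 1 + C (-x) * X := by rw [map_neg]; ring
  rw [h]
  ext n
  cases n with
  | zero =>
    rw [add_mul, one_mul, mul_assoc, map_add, coeff_C_mul, coeff_zero_X_mul, coeff_rescale,
      coeff_rescale]
    simp
  | succ n =>
    rw [coeff_succ_one_add_C_mul_X_mul]
    simp only [coeff_rescale, invPochSeries, coeff_mk, qPoch_succ]
    have h1 := qPoch_ne_zero q hq n
    have h2 := one_sub_pow_ne_zero q hq n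
    field_simp
    ring

theorem rescale_pochSeries (q : ℂ) (hq : ‖q‖ < 1) (x : ℂ) :
    rescale x (pochSeries q) = (1 + C x * X) * rescale (x * q) (pochSeries q) := by
  ext n
  cases n with
  | zero =>
    rw [add_mul, one_mul, mul_assoc, map_add, coeff_C_mul, coeff_zero_X_mul, coeff_rescale,
      coeff_rescale]
    simp
  | succ n =>
    rw [coeff_succ_one_add_C_mul_X_mul]
    simp only [coeff_rescale, pochSeries, coeff_mk, qPoch_succ, Nat.choose_succ_succ' n 1,
      Nat.choose_one_right]
    have h1 := qPoch_ne_zero q hq n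
    have h2 := one_sub_pow_ne_zero q hq n
    field_simp
    ring

theorem invPochSqSeries_mul (q : ℂ) (hq : ‖q‖ < 1) (y : ℂ) :
    invPochSqSeries q (y * q) = (1 - C y * X ^ 2) * invPochSqSeries q y := by
  ext n
  rw [sub_mul, one_mul, mul_assoc, map_sub, coeff_C_mul]
  rcases n with _ | _ | n
  · simp [invPochSqSeries, coeff_X_pow_mul']
  · simp [invPochSqSeries, coeff_X_pow_mul']
  · rw [show n + 1 + 1 = n + 2 from rfl, coeff_X_pow_mul]
    simp only [invPochSqSeries, coeff_mk]
    by_cases hn : Even n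
    · have h3 : Even (n + 1 + 1) := by simpa [Nat.even_add_one] using hn
      have h4 : (n + 1 + 1) / 2 = n / 2 + 1 := by omega
      rw [if_pos hn, if_pos h3, h4, qPoch_succ]
      have h1 := qPoch_ne_zero q hq (n / 2)
      have h2 := one_sub_pow_ne_zero q hq (n / 2)
      rw [if_pos h3]
      field_simp
      ring
    · have h3 : ¬ Even (n + 1 + 1) := by simpa [Nat.even_add_one] using hn
      simp [hn, h3]

theorem rescale_invPochSqSeries (q y : ℂ) :
    rescale q (invPochSqSeries q y) = invPochSqSeries q (y * q * q) := by
  ext n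
  simp only [coeff_rescale, invPochSqSeries, coeff_mk]
  split_ifs with hn
  · obtain ⟨k, rfl⟩ := hn
    have : (k + k) / 2 = k := by omega
    rw [this]
    ring
  · simp

/-- Power series with a positive radius of absolute convergence. -/
def PosRadius (f : ℂ⟦X⟧) : Prop := ∃ r : ℝ, 0 < r ∧ Summable fun n => ‖coeff n f‖ * r ^ n

theorem PosRadius.of_le {f : ℂ⟦X⟧} {K : ℝ} (hK : 0 ≤ K) (h : ∀ n, ‖coeff n f‖ ≤ K ^ n) :
    PosRadius f := by
  refine ⟨(2 * (K + 1))⁻¹, by positivity, ?_⟩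
  refine Summable.of_nonneg_of_le (fun n => by positivity) (fun n => ?_) summable_geometric_two
  calc ‖coeff n f‖ * (2 * (K + 1))⁻¹ ^ n ≤ K ^ n * (2 * (K + 1))⁻¹ ^ n := by
        gcongr
        exact h n
    _ = (K * (2 * (K + 1))⁻¹) ^ n := (mul_pow _ _ _).symm
    _ ≤ (1 / 2) ^ n := by
        gcongr
        rw [mul_inv_le_iff₀ (by positivity)]
        linarith

theorem PosRadius.mul {f g : ℂ⟦X⟧} (hf : PosRadius f) (hg : PosRadius g) :
    PosRadius (f * g) := by
  obtain ⟨r, hr, hfr⟩ := hf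
  obtain ⟨r', hr', hgr⟩ := hg
  set ρ := min r r' with hρ
  have hρ0 : 0 < ρ := lt_min hr hr'
  have h1 : Summable fun n => ‖coeff n f * (ρ : ℂ) ^ n‖ := by
    refine Summable.of_nonneg_of_le (fun n => norm_nonneg _) (fun n => ?_) hfr
    rw [norm_mul, norm_pow, Complex.norm_real, Real.norm_of_nonneg hρ0.le]
    gcongr
    exact min_le_left _ _
  have h2 : Summable fun n => ‖coeff n g * (ρ : ℂ) ^ n‖ := by
    refine Summable.of_nonneg_of_le (fun n => norm_nonneg _) (fun n => ?_) hgr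
    rw [norm_mul, norm_pow, Complex.norm_real, Real.norm_of_nonneg hρ0.le]
    gcongr
    exact min_le_right _ _
  refine ⟨ρ, hρ0, (summable_norm_sum_mul_antidiagonal_of_summable_norm h1 h2).congr fun n => ?_⟩
  have h3 : ∑ kl ∈ Finset.HasAntidiagonal.antidiagonal n, coeff kl.1 f * (ρ : ℂ) ^ kl.1 *
      (coeff kl.2 g * (ρ : ℂ) ^ kl.2) = coeff n (f * g) * (ρ : ℂ) ^ n := by
    rw [coeff_mul, Finset.sum_mul]
    refine Finset.sum_congr rfl fun kl hkl => ?_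
    rw [← Finset.HasAntidiagonal.mem_antidiagonal.1 hkl, pow_add]
    ring
  rw [h3, norm_mul, norm_pow, Complex.norm_real, Real.norm_of_nonneg hρ0.le]

theorem posRadius_rescale_invPochSeries (q : ℂ) (hq : ‖q‖ < 1) (x : ℂ) :
    PosRadius (rescale x (invPochSeries q)) := by
  have h0 : 0 < 1 - ‖q‖ := by linarith
  refine PosRadius.of_le (K := ‖x‖ * (1 - ‖q‖)⁻¹) (by positivity) fun n => ?_
  rw [coeff_rescale, invPochSeries, coeff_mk, norm_mul, norm_pow, mul_pow]
  gcongr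
  exact norm_inv_qPoch_le q hq n

theorem posRadius_rescale_pochSeries (q : ℂ) (hq : ‖q‖ < 1) (x : ℂ) :
    PosRadius (rescale x (pochSeries q)) := by
  have h0 : 0 < 1 - ‖q‖ := by linarith
  refine PosRadius.of_le (K := ‖x‖ * (1 - ‖q‖)⁻¹) (by positivity) fun n => ?_
  rw [coeff_rescale, pochSeries, coeff_mk, norm_mul, norm_mul, norm_pow, norm_pow, mul_pow]
  gcongr
  calc _ ≤ 1 * ‖(qPoch q n)⁻¹‖ := by
        gcongr
        exact pow_le_one₀ (norm_nonneg _) hq.le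
    _ ≤ _ := by
        rw [one_mul]
        exact norm_inv_qPoch_le q hq n

theorem posRadius_invPochSqSeries (q : ℂ) (hq : ‖q‖ < 1) (y : ℂ) :
    PosRadius (invPochSqSeries q y) := by
  have h0 : 0 < 1 - ‖q‖ := by linarith
  refine PosRadius.of_le (K := 1 + ‖y‖ * (1 - ‖q‖)⁻¹) (by positivity) fun n => ?_
  rw [invPochSqSeries, coeff_mk]
  split_ifs
  · rw [norm_mul, norm_pow]
    calc ‖y‖ ^ (n / 2) * ‖(qPoch q (n / 2))⁻¹‖ ≤ ‖y‖ ^ (n / 2) * (1 - ‖q‖)⁻¹ ^ (n / 2) := by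
          gcongr
          exact norm_inv_qPoch_le q hq _
      _ = (‖y‖ * (1 - ‖q‖)⁻¹) ^ (n / 2) := (mul_pow _ _ _).symm
      _ ≤ (1 + ‖y‖ * (1 - ‖q‖)⁻¹) ^ (n / 2) := by
          gcongr
          linarith
      _ ≤ (1 + ‖y‖ * (1 - ‖q‖)⁻¹) ^ n := by
          refine pow_le_pow_right₀ ?_ (Nat.div_le_self n 2)
          have : 0 ≤ ‖y‖ * (1 - ‖q‖)⁻¹ := by positivity
          linarith
  · rw [norm_zero]
    positivity

theorem exists_pow_choose_two_mul_pow_le {t K : ℝ} (ht : 0 ≤ t) (ht1 : t < 1) (hK : 0 ≤ K) :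
    ∃ B, ∀ n : ℕ, t ^ (n + 1).choose 2 * K ^ n ≤ B := by
  have hlim : Tendsto (fun m : ℕ => t ^ m * K) atTop (𝓝 (0 * K)) :=
    (tendsto_pow_atTop_nhds_zero_of_lt_one ht ht1).mul_const K
  rw [zero_mul] at hlim
  obtain ⟨m, hm⟩ := (hlim.eventually_lt_const one_pos).exists_forall_of_atTop
  set g : ℕ → ℝ := fun n => t ^ (n + 1).choose 2 * K ^ n with hg
  have hg0 : ∀ n, 0 ≤ g n := fun n => by positivity
  refine ⟨∑ k ∈ Finset.range (m + 1), g k, fun n => ?_⟩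
  change g n ≤ _
  rcases le_total n m with hn | hn
  · exact Finset.single_le_sum (fun k _ => hg0 k) (Finset.mem_range.2 (by omega))
  · induction n, hn using Nat.le_induction with
    | base => exact Finset.single_le_sum (fun k _ => hg0 k) (Finset.mem_range.2 (by omega))
    | succ n hn ih =>
      refine le_trans ?_ ih
      have h1 : g (n + 1) = g n * (t ^ (n + 1) * K) := by
        simp only [hg]
        rw [Nat.choose_succ_succ' (n + 1) 1, Nat.choose_one_right]
        ring
      rw [h1]
      exact mul_le_of_le_one_right (hg0 n) (hm (n + 1) (by omega)).le

theorem PosRadius.summable {f : ℂ⟦X⟧} (hf : PosRadius f) (q : ℂ) (hq : ‖q‖ < 1) :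
    Summable fun n => q ^ (n + 1).choose 2 * coeff n f := by
  obtain ⟨r, hr, hfr⟩ := hf
  obtain ⟨B, hB⟩ := exists_pow_choose_two_mul_pow_le (norm_nonneg q) hq (inv_nonneg.2 hr.le)
  refine Summable.of_norm_bounded (hfr.mul_left B) fun n => ?_
  rw [norm_mul, norm_pow]
  calc ‖q‖ ^ (n + 1).choose 2 * ‖coeff n f‖
      = ‖q‖ ^ (n + 1).choose 2 * r⁻¹ ^ n * (‖coeff n f‖ * r ^ n) := by
        rw [inv_pow]
        field_simp
    _ ≤ B * (‖coeff n f‖ * r ^ n) := by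
        gcongr
        exact hB n

/-- Rescaling a power series by `q` corresponds, up to a factor `q`, to multiplying it by the
variable, for the functional `z ^ n ↦ q ^ (n (n + 1) / 2)`. -/
theorem PosRadius.hasSum_X_mul_sub_rescale {f : ℂ⟦X⟧} (hf : PosRadius f) (q : ℂ)
    (hq : ‖q‖ < 1) :
    HasSum (fun n => q ^ (n + 1).choose 2 * coeff n (X * f - C q * rescale q f)) 0 := by
  have h1 : ∀ n, q ^ (n + 1 + 1).choose 2 * coeff (n + 1) (X * f) =
      q ^ (n + 1).choose 2 * coeff n (C q * rescale q f) := by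
    intro n
    rw [coeff_succ_X_mul, coeff_C_mul, coeff_rescale, Nat.choose_succ_succ' (n + 1) 1,
      Nat.choose_one_right]
    ring
  have hs : Summable fun n => q ^ (n + 1 + 1).choose 2 * coeff (n + 1) (X * f) := by
    have h2 : PosRadius (C q * rescale q f) := by
      obtain ⟨r, hr, hfr⟩ := hf
      refine ⟨r, hr, Summable.of_nonneg_of_le (fun n => by positivity) (fun n => ?_)
        (hfr.mul_left ‖q‖)⟩
      rw [coeff_C_mul, coeff_rescale, norm_mul, norm_mul, norm_pow, mul_assoc]
      gcongr
      exact mul_le_of_le_one_left (norm_nonneg _) (pow_le_one₀ (norm_nonneg _) hq.le)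
    exact (h2.summable q hq).congr fun n => (h1 n).symm
  have h3 := (hasSum_nat_add_iff (f := fun n => q ^ (n + 1).choose 2 * coeff n (X * f)) 1).1
    hs.hasSum
  have h4 := hs.hasSum
  simp only [h1] at h4
  rw [tsum_congr h1] at h3
  have h5 := h3.sub h4
  simp only [Finset.range_one, Finset.sum_singleton, coeff_zero_X_mul, mul_zero, add_zero,
    sub_self, ← mul_sub, ← map_sub] at h5
  exact h5

/-- Whether a residue modulo ten is the index of a secondary color. -/
def secIdx (p : ℕ) : Bool := !(p == 3 || p == 6 || p == 8 || p == 9)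

/-- The least position allowed for the predecessor of a part in position `s`, where the part of
size `k` and color of index `i` has position `10 * k + i`. -/
def partGap (s : ℕ) : ℕ := s + (secIdx (s % 10)).toNat + 10

/-- The weight of the part in position `s`, given the weights of the colors. -/
noncomputable def partWeight (q : ℂ) (x : ℕ → ℂ) (s : ℕ) : ℂ := x (s % 10) * q ^ (s / 10)

/-- The infinite product contributed by a single color. -/
noncomputable def colorSeries (q : ℂ) (p : ℕ) (y : ℂ) : ℂ⟦X⟧ :=
  if secIdx p then rescale y (pochSeries q) else rescale y (invPochSeries q)

/-- The product encoding the chains of parts in positions at least `s`. -/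
noncomputable def chainSeries (q : ℂ) (x : ℕ → ℂ) (s : ℕ) : ℂ⟦X⟧ :=
  ∏ p ∈ Finset.range 10, colorSeries q p (x p * q ^ ((s + 9 - p) / 10))

theorem lt_partGap (s : ℕ) : s < partGap s := by
  unfold partGap
  omega

theorem rescale_colorSeries (q : ℂ) (p : ℕ) (y z : ℂ) :
    rescale z (colorSeries q p y) = colorSeries q p (y * z) := by
  unfold colorSeries
  split_ifs <;> rw [rescale_rescale]

theorem chainSeries_add_ten (q : ℂ) (x : ℕ → ℂ) (s : ℕ) :
    chainSeries q x (s + 10) = rescale q (chainSeries q x s) := by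
  unfold chainSeries
  rw [map_prod]
  refine Finset.prod_congr rfl fun p hp => ?_
  have hp := Finset.mem_range.1 hp
  have h : (s + 10 + 9 - p) / 10 = (s + 9 - p) / 10 + 1 := by omega
  rw [rescale_colorSeries, h, pow_succ, mul_assoc]

theorem coeff_zero_chainSeries (q : ℂ) (x : ℕ → ℂ) (s : ℕ) :
    coeff 0 (chainSeries q x s) = 1 := by
  rw [coeff_zero_eq_constantCoeff_apply, chainSeries, map_prod]
  refine Finset.prod_eq_one fun p _ => ?_
  rw [← coeff_zero_eq_constantCoeff_apply, colorSeries]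
  split_ifs <;> rw [coeff_rescale] <;> simp only [pochSeries, invPochSeries, coeff_mk] <;>
    simp [qPoch]

theorem chainSeries_eq_mul_erase (q : ℂ) (x : ℕ → ℂ) (s : ℕ) :
    chainSeries q x s = colorSeries q (s % 10) (partWeight q x s) *
      ∏ p ∈ (Finset.range 10).erase (s % 10),
        colorSeries q p (x p * q ^ ((s + 9 - p) / 10)) := by
  have hs : s % 10 ∈ Finset.range 10 := Finset.mem_range.2 (Nat.mod_lt _ (by norm_num))
  have h : (s + 9 - s % 10) / 10 = s / 10 := by omega
  rw [chainSeries, ← Finset.mul_prod_erase _ _ hs, h, partWeight]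

theorem chainSeries_succ_eq_mul_erase (q : ℂ) (x : ℕ → ℂ) (s : ℕ) :
    chainSeries q x (s + 1) = colorSeries q (s % 10) (partWeight q x s * q) *
      ∏ p ∈ (Finset.range 10).erase (s % 10),
        colorSeries q p (x p * q ^ ((s + 9 - p) / 10)) := by
  have hs : s % 10 ∈ Finset.range 10 := Finset.mem_range.2 (Nat.mod_lt _ (by norm_num))
  have h : (s + 1 + 9 - s % 10) / 10 = s / 10 + 1 := by omega
  rw [chainSeries, ← Finset.mul_prod_erase _ _ hs, h, partWeight, pow_succ, ← mul_assoc]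
  congr 1
  refine Finset.prod_congr rfl fun p hp => ?_
  obtain ⟨h1, h2⟩ := Finset.mem_erase.1 hp
  have h2 := Finset.mem_range.1 h2
  have h3 : (s + 1 + 9 - p) / 10 = (s + 9 - p) / 10 := by omega
  rw [h3]

theorem chainSeries_succ_of_primary (q : ℂ) (hq : ‖q‖ < 1) (x : ℕ → ℂ) (s : ℕ)
    (hs : secIdx (s % 10) = false) :
    chainSeries q x (s + 1) = (1 - C (partWeight q x s) * X) * chainSeries q x s := by
  rw [chainSeries_succ_eq_mul_erase, chainSeries_eq_mul_erase, ← mul_assoc]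
  congr 1
  simp only [colorSeries, hs]
  exact rescale_invPochSeries q hq _

theorem chainSeries_of_secondary (q : ℂ) (hq : ‖q‖ < 1) (x : ℕ → ℂ) (s : ℕ)
    (hs : secIdx (s % 10) = true) :
    chainSeries q x s = (1 + C (partWeight q x s) * X) * chainSeries q x (s + 1) := by
  rw [chainSeries_succ_eq_mul_erase, chainSeries_eq_mul_erase, ← mul_assoc]
  congr 1
  simp only [colorSeries, hs]
  exact rescale_pochSeries q hq _

theorem chainSeries_step (q : ℂ) (hq : ‖q‖ < 1) (x : ℕ → ℂ) (s : ℕ) :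
    chainSeries q x s = chainSeries q x (s + 1) +
      C (partWeight q x s) * (X * chainSeries q x (s + (secIdx (s % 10)).toNat)) := by
  cases hs : secIdx (s % 10)
  · rw [chainSeries_succ_of_primary q hq x s hs]
    simp only [Bool.toNat_false, add_zero]
    ring
  · rw [chainSeries_of_secondary q hq x s hs]
    simp only [Bool.toNat_true]
    ring

theorem norm_periodic_le {f : ℕ → ℂ} {t : ℂ} (h : ∀ s, f (s + 10) = t * f s) :
    ∃ B, ∀ s, ‖f s‖ ≤ B * ‖t‖ ^ (s / 10) := by
  have h1 : ∀ r k, f (r + 10 * k) = t ^ k * f r := by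
    intro r k
    induction k with
    | zero => simp
    | succ k ih => rw [mul_add, ← add_assoc, mul_one, h, ih, pow_succ]; ring
  refine ⟨∑ r ∈ Finset.range 10, ‖f r‖, fun s => ?_⟩
  conv_lhs => rw [← Nat.mod_add_div s 10, h1, norm_mul, norm_pow, mul_comm]
  gcongr
  exact Finset.single_le_sum (f := fun r => ‖f r‖) (fun _ _ => norm_nonneg _)
    (Finset.mem_range.2 (Nat.mod_lt _ (by norm_num)))

theorem summable_norm_partWeight (q : ℂ) (hq : ‖q‖ < 1) (x : ℕ → ℂ) :
    Summable fun s => ‖partWeight q x s‖ := by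
  have h : Summable fun p : ℕ × Fin 10 => ‖q‖ ^ p.1 * ‖x p.2‖ :=
    Summable.mul_of_nonneg (f := fun k : ℕ => ‖q‖ ^ k) (g := fun i : Fin 10 => ‖x i‖)
      (summable_geometric_of_lt_one (norm_nonneg _) hq) Summable.of_finite
      (fun _ => by positivity) (fun _ => norm_nonneg _)
  refine (h.comp_injective (Nat.divModEquiv 10).injective).congr fun s => ?_
  rw [Function.comp_apply, Nat.divModEquiv_apply, partWeight, norm_mul, norm_pow, mul_comm]
  rfl

theorem tendsto_coeff_chainSeries (q : ℂ) (hq : ‖q‖ < 1) (x : ℕ → ℂ) (τ : ℕ) :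
    Tendsto (fun s => coeff (τ + 1) (chainSeries q x s)) atTop (𝓝 0) := by
  obtain ⟨B, hB⟩ := norm_periodic_le (f := fun s => coeff (τ + 1) (chainSeries q x s))
    (t := q ^ (τ + 1)) fun s => by rw [chainSeries_add_ten, coeff_rescale]
  have h1 : ‖q ^ (τ + 1)‖ < 1 := by
    rw [norm_pow]
    exact pow_lt_one₀ (norm_nonneg _) hq (Nat.succ_ne_zero τ)
  have h2 : Tendsto (fun s : ℕ => B * ‖q ^ (τ + 1)‖ ^ (s / 10)) atTop (𝓝 (B * 0)) :=
    ((tendsto_pow_atTop_nhds_zero_of_lt_one (norm_nonneg _) h1).comp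
      (Nat.tendsto_div_const_atTop (by norm_num))).const_mul B
  rw [mul_zero] at h2
  exact squeeze_zero_norm hB h2

theorem hasSum_partChains (q : ℂ) (hq : ‖q‖ < 1) (x : ℕ → ℂ) (τ s : ℕ) :
    HasSum ((gapChains partGap τ s).indicator fun l => (l.map (partWeight q x)).prod)
      (q ^ τ.choose 2 * coeff τ (chainSeries q x s)) := by
  refine hasSum_gapChains (partWeight q x) (summable_norm_partWeight q hq x) lt_partGap
    (fun τ s => q ^ τ.choose 2 * coeff τ (chainSeries q x s)) (fun s => ?_) (fun τ s => ?_)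
    (fun τ => ?_) τ s
  · simp only [coeff_zero_chainSeries]
    simp
  · rw [chainSeries_step q hq x s, map_add, coeff_C_mul, coeff_succ_X_mul, partGap,
      chainSeries_add_ten, coeff_rescale, Nat.choose_succ_succ' τ 1, Nat.choose_one_right]
    ring
  · simpa using (tendsto_coeff_chainSeries q hq x τ).const_mul (q ^ (τ + 1).choose 2)

theorem hasSum_quaternaryChains (q : ℂ) (hq : ‖q‖ < 1) (e : ℂ) (m M : ℕ) :
    HasSum ((gapChains (· + 4) m M).indicator fun l => (l.map fun k => e * q ^ k).prod)
      (e ^ m * q ^ (4 * m.choose 2 + M * m) * (qPoch q m)⁻¹) := by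
  have hw : Summable fun k : ℕ => ‖e * q ^ k‖ := by
    simp only [norm_mul, norm_pow]
    exact (summable_geometric_of_lt_one (norm_nonneg _) hq).mul_left _
  refine hasSum_gapChains (fun k => e * q ^ k) hw (fun s => by omega)
    (fun m M => e ^ m * q ^ (4 * m.choose 2 + M * m) * (qPoch q m)⁻¹) (fun s => ?_)
    (fun m M => ?_) (fun m => ?_) m M
  · simp [qPoch]
  · have h1 := qPoch_ne_zero q hq m
    have h2 := one_sub_pow_ne_zero q hq m
    rw [qPoch_succ, Nat.choose_succ_succ' m 1, Nat.choose_one_right]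
    field_simp
    ring
  · have h1 : ‖q ^ (m + 1)‖ < 1 := by
      rw [norm_pow]
      exact pow_lt_one₀ (norm_nonneg _) hq (Nat.succ_ne_zero m)
    have h2 := (tendsto_pow_atTop_nhds_zero_of_norm_lt_one h1).const_mul
      (e ^ (m + 1) * q ^ (4 * (m + 1).choose 2) * (qPoch q (m + 1))⁻¹)
    rw [mul_zero] at h2
    refine h2.congr fun M => ?_
    ring

/-- The positions of the parts of a quaternary partition: in size one, only primary parts are
allowed. -/
def IsPartPos (s : ℕ) : Prop := s = 13 ∨ s = 16 ∨ s = 18 ∨ s = 19 ∨ 20 ≤ s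

/-- The lists of positions of the primary and secondary parts of quaternary partitions. -/
def posChains : Set (List ℕ) :=
  {l | l.Pairwise (fun x y => partGap y ≤ x) ∧ ∀ s ∈ l, IsPartPos s}

/-- Quaternary partitions whose primary and secondary parts are encoded by their positions. -/
def posAAB : Set (List ℕ × List ℕ) :=
  {p | p.1 ∈ posChains ∧ p.2.Pairwise (fun x y => y + 4 ≤ x) ∧
    ∀ K ∈ p.2, 4 + 2 * p.1.length - (if 13 ∈ p.1 then 1 else 0) ≤ K}

/-- The weight of a quaternary partition, given the weights of the colors. -/
noncomputable def posWeight (q e : ℂ) (x : ℕ → ℂ) (p : List ℕ × List ℕ) : ℂ :=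
  (p.1.map (partWeight q x)).prod * (p.2.map fun k => e * q ^ k).prod

theorem partGap_le_or_of_pairwise {l : List ℕ} (hl : l.Pairwise (fun x y => partGap y ≤ x))
    {x y : ℕ} (hx : x ∈ l) (hy : y ∈ l) (hxy : x ≠ y) : partGap y ≤ x ∨ partGap x ≤ y :=
  have : Std.Symm fun x y => partGap y ≤ x ∨ partGap x ≤ y := ⟨fun _ _ h => Or.symm h⟩
  List.Pairwise.forall (R := fun x y => partGap y ≤ x ∨ partGap x ≤ y)
    (hl.imp fun h => Or.inl h) hx hy hxy

theorem ten_add_le_of_pairwise {l : List ℕ} (hl : l.Pairwise (fun x y => partGap y ≤ x))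
    {x y : ℕ} (hx : x ∈ l) (hy : y ∈ l) (hxy : x < y) : x + 10 ≤ y := by
  rcases partGap_le_or_of_pairwise hl hx hy hxy.ne with h | h <;> unfold partGap at h <;> omega

theorem gapChains_anti (gap : ℕ → ℕ) (τ : ℕ) {s t : ℕ} (h : s ≤ t) :
    gapChains gap τ t ⊆ gapChains gap τ s :=
  fun _ hl => ⟨hl.1, hl.2.1, fun x hx => h.trans (hl.2.2 x hx)⟩

theorem mem_of_mem_gapChains_diff {gap : ℕ → ℕ} {τ s : ℕ} {l : List ℕ}
    (h : l ∈ gapChains gap τ s \ gapChains gap τ (s + 1)) : s ∈ l := by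
  obtain ⟨⟨h1, h2, h3⟩, h4⟩ := h
  by_contra hs
  refine h4 ⟨h1, h2, fun x hx => ?_⟩
  have h5 := h3 x hx
  have h6 : x ≠ s := by
    rintro rfl
    exact hs hx
  omega

theorem posChains_of_mem (τ : ℕ) :
    {l | l ∈ posChains ∧ l.length = τ ∧ 13 ∈ l} =
      gapChains partGap τ 13 \ gapChains partGap τ 14 := by
  ext l
  constructor
  · rintro ⟨⟨h1, h2⟩, h3, h4⟩
    refine ⟨⟨h3, h1, fun s hs => ?_⟩, fun h => ?_⟩
    · have := h2 s hs
      unfold IsPartPos at this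
      omega
    · have := h.2.2 13 h4
      omega
  · intro h
    have h13 := mem_of_mem_gapChains_diff h
    refine ⟨⟨h.1.2.1, fun s hs => ?_⟩, h.1.1, h13⟩
    have h1 := h.1.2.2 s hs
    rcases h1.eq_or_lt with rfl | h1
    · exact Or.inl rfl
    · have := ten_add_le_of_pairwise h.1.2.1 h13 hs h1
      unfold IsPartPos
      omega

theorem posChains_of_notMem (τ : ℕ) :
    {l | l ∈ posChains ∧ l.length = τ ∧ 13 ∉ l} =
      (gapChains partGap τ 16 \ gapChains partGap τ 17) ∪ gapChains partGap τ 18 := by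
  ext l
  constructor
  · rintro ⟨⟨h1, h2⟩, h3, h4⟩
    have h5 : ∀ s ∈ l, s = 16 ∨ 18 ≤ s := by
      intro s hs
      have h6 := h2 s hs
      have h7 : s ≠ 13 := by
        rintro rfl
        exact h4 hs
      unfold IsPartPos at h6
      omega
    by_cases h6 : 16 ∈ l
    · refine Or.inl ⟨⟨h3, h1, fun s hs => ?_⟩, fun h => ?_⟩
      · have := h5 s hs
        omega
      · have := h.2.2 16 h6
        omega
    · refine Or.inr ⟨h3, h1, fun s hs => ?_⟩
      rcases h5 s hs with rfl | h
      · exact (h6 hs).elim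
      · exact h
  · rintro (h | h)
    · have h16 := mem_of_mem_gapChains_diff h
      refine ⟨⟨h.1.2.1, fun s hs => ?_⟩, h.1.1, fun h13 => ?_⟩
      · have h1 := h.1.2.2 s hs
        rcases h1.eq_or_lt with rfl | h1
        · exact Or.inr (Or.inl rfl)
        · have := ten_add_le_of_pairwise h.1.2.1 h16 hs h1
          unfold IsPartPos
          omega
      · have := h.1.2.2 13 h13
        omega
    · refine ⟨⟨h.2.1, fun s hs => ?_⟩, h.1, fun h13 => ?_⟩
      · have := h.2.2 s hs
        unfold IsPartPos
        omega
      · have := h.2.2 13 h13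
        omega

theorem hasSum_posChains_of_mem (q : ℂ) (hq : ‖q‖ < 1) (x : ℕ → ℂ) (τ : ℕ) :
    HasSum ({l | l ∈ posChains ∧ l.length = τ ∧ 13 ∈ l}.indicator
      fun l => (l.map (partWeight q x)).prod)
      (q ^ (τ + 1).choose 2 * coeff τ (chainSeries q x 3 - chainSeries q x 4)) := by
  rw [posChains_of_mem, Set.indicator_sdiff (gapChains_anti _ _ (Nat.le_succ 13))]
  refine (congrArg (fun z => HasSum _ z) ?_).mpr
    ((hasSum_partChains q hq x τ 13).sub (hasSum_partChains q hq x τ 14))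
  rw [chainSeries_add_ten q x 3, chainSeries_add_ten q x 4, coeff_rescale, coeff_rescale, map_sub,
    Nat.choose_succ_succ' τ 1, Nat.choose_one_right]
  ring

theorem hasSum_posChains_of_notMem (q : ℂ) (hq : ‖q‖ < 1) (x : ℕ → ℂ) (τ : ℕ) :
    HasSum ({l | l ∈ posChains ∧ l.length = τ ∧ 13 ∉ l}.indicator
      fun l => (l.map (partWeight q x)).prod)
      (q ^ (τ + 1).choose 2 *
        coeff τ (chainSeries q x 6 - chainSeries q x 7 + chainSeries q x 8)) := by
  rw [posChains_of_notMem, Set.indicator_union_of_disjoint,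
    Set.indicator_sdiff (gapChains_anti _ _ (Nat.le_succ 16))]
  · refine (congrArg (fun z => HasSum _ z) ?_).mpr
      (((hasSum_partChains q hq x τ 16).sub (hasSum_partChains q hq x τ 17)).add
        (hasSum_partChains q hq x τ 18))
    rw [chainSeries_add_ten q x 6, chainSeries_add_ten q x 7, chainSeries_add_ten q x 8,
      coeff_rescale, coeff_rescale, coeff_rescale, map_add, map_sub,
      Nat.choose_succ_succ' τ 1, Nat.choose_one_right]
    ring
  · exact Set.disjoint_left.2 fun l h1 h2 => h1.2 (gapChains_anti _ _ (Nat.le_succ 17) h2)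

theorem indicator_posAAB_of_length (q e : ℂ) (x : ℕ → ℂ) (τ m : ℕ) (p : List ℕ × List ℕ) :
    ((fun p : List ℕ × List ℕ => (p.1.length, p.2.length)) ⁻¹' {(τ, m)}).indicator
      (posAAB.indicator (posWeight q e x)) p =
    {l | l ∈ posChains ∧ l.length = τ ∧ 13 ∈ l}.indicator
        (fun l => (l.map (partWeight q x)).prod) p.1 *
      (gapChains (· + 4) m (2 * τ + 3)).indicator
        (fun l => (l.map fun k => e * q ^ k).prod) p.2 +
    {l | l ∈ posChains ∧ l.length = τ ∧ 13 ∉ l}.indicator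
        (fun l => (l.map (partWeight q x)).prod) p.1 *
      (gapChains (· + 4) m (2 * τ + 4)).indicator
        (fun l => (l.map fun k => e * q ^ k).prod) p.2 := by
  classical
  obtain ⟨l, Q⟩ := p
  simp only [Set.indicator_apply, Set.mem_preimage, Set.mem_singleton_iff, Prod.mk.injEq,
    Set.mem_ofPred_eq, posAAB, gapChains, posWeight]
  by_cases h1 : l.length = τ
  swap
  · simp [h1]
  by_cases h2 : l ∈ posChains
  swap
  · simp [h2]
  by_cases h3 : Q.length = m
  swap
  · simp [h3]
  by_cases h5 : 13 ∈ l
  · have h6 : 4 + 2 * l.length - 1 = 2 * τ + 3 := by omega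
    simp only [h1, h2, h3, h5, if_true, true_and, and_true, not_true_eq_false, if_false, zero_mul,
      ← h6, mul_ite, mul_zero, ite_self, add_zero]
  · have h6 : 4 + 2 * l.length = 2 * τ + 4 := by omega
    simp only [h1, h2, h3, h5, if_true, true_and, and_true, not_false_eq_true, if_false, zero_mul,
      ← h6, mul_ite, mul_zero, Nat.sub_zero, ite_self, zero_add]

theorem choose_two_add (τ m : ℕ) :
    (τ + 1).choose 2 + (4 * m.choose 2 + (2 * τ + 3) * m) = (τ + 2 * m + 1).choose 2 := by
  induction m with
  | zero => simp
  | succ m ih =>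
    rw [Nat.choose_succ_succ' m 1, Nat.choose_one_right,
      show τ + 2 * (m + 1) + 1 = τ + 2 * m + 1 + 1 + 1 by ring,
      Nat.choose_succ_succ' (τ + 2 * m + 1 + 1) 1, Nat.choose_one_right,
      Nat.choose_succ_succ' (τ + 2 * m + 1) 1, Nat.choose_one_right, ← ih]
    ring

theorem coeff_two_mul_invPochSqSeries (q y : ℂ) (m : ℕ) :
    coeff (2 * m) (invPochSqSeries q y) = y ^ m * (qPoch q m)⁻¹ := by
  rw [invPochSqSeries, coeff_mk, if_pos (even_two_mul m), Nat.mul_div_cancel_left m two_pos]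

/-- The power series from which the generating function of quaternary partitions is obtained by
the substitution `z ^ n ↦ q ^ (n (n + 1) / 2)`. -/
noncomputable def aabSeries (q e : ℂ) (x : ℕ → ℂ) : ℂ⟦X⟧ :=
  (chainSeries q x 3 - chainSeries q x 4) * invPochSqSeries q e +
    (chainSeries q x 6 - chainSeries q x 7 + chainSeries q x 8) * invPochSqSeries q (e * q)

theorem hasSum_posAAB_of_length (q : ℂ) (hq : ‖q‖ < 1) (e : ℂ) (x : ℕ → ℂ) (τ m : ℕ) :
    HasSum (((fun p : List ℕ × List ℕ => (p.1.length, p.2.length)) ⁻¹' {(τ, m)}).indicator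
      (posAAB.indicator (posWeight q e x)))
      (q ^ (τ + 2 * m + 1).choose 2 *
        (coeff τ (chainSeries q x 3 - chainSeries q x 4) *
            coeff (2 * m) (invPochSqSeries q e) +
          coeff τ (chainSeries q x 6 - chainSeries q x 7 + chainSeries q x 8) *
            coeff (2 * m) (invPochSqSeries q (e * q)))) := by
  rw [funext (indicator_posAAB_of_length q e x τ m)]
  have h1 := hasSum_posChains_of_mem q hq x τ
  have h2 := hasSum_quaternaryChains q hq e m (2 * τ + 3)
  have h3 := hasSum_posChains_of_notMem q hq x τ
  have h4 := hasSum_quaternaryChains q hq e m (2 * τ + 4)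
  refine (congrArg (fun z => HasSum _ z) ?_).mpr
    ((h1.mul h2 (summable_mul_of_summable_norm h1.summable.norm h2.summable.norm)).add
      (h3.mul h4 (summable_mul_of_summable_norm h3.summable.norm h4.summable.norm)))
  rw [← choose_two_add, coeff_two_mul_invPochSqSeries, coeff_two_mul_invPochSqSeries]
  ring

theorem summable_norm_posAAB (q : ℂ) (hq : ‖q‖ < 1) (e : ℂ) (x : ℕ → ℂ) :
    Summable fun p => ‖posAAB.indicator (posWeight q e x) p‖ := by
  have hw : Summable fun k : ℕ => ‖e * q ^ k‖ := by
    simp only [norm_mul, norm_pow]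
    exact (summable_geometric_of_lt_one (norm_nonneg _) hq).mul_left _
  have h1 := summable_norm_indicator_of_pairwise_gt (partWeight q x)
    (summable_norm_partWeight q hq x) (S := {l | l.Pairwise (· > ·)}) fun _ hl => hl
  have h2 := summable_norm_indicator_of_pairwise_gt (fun k => e * q ^ k) hw
    (S := {l | l.Pairwise (· > ·)}) fun _ hl => hl
  refine Summable.of_nonneg_of_le (fun _ => norm_nonneg _) (fun p => ?_)
    (h1.mul_of_nonneg h2 (fun _ => norm_nonneg _) fun _ => norm_nonneg _)
  by_cases hp : p ∈ posAAB
  · have h3 : p.1 ∈ {l : List ℕ | l.Pairwise (· > ·)} :=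
      hp.1.1.imp fun {a b} (h : partGap b ≤ a) => lt_of_lt_of_le (lt_partGap b) h
    have h4 : p.2 ∈ {l : List ℕ | l.Pairwise (· > ·)} :=
      hp.2.1.imp fun {a b} (h : b + 4 ≤ a) => by omega
    rw [Set.indicator_of_mem hp, Set.indicator_of_mem h3, Set.indicator_of_mem h4, posWeight,
      norm_mul]
  · rw [Set.indicator_of_notMem hp, norm_zero]
    positivity

theorem hasSum_aabSeries (q : ℂ) (hq : ‖q‖ < 1) (e : ℂ) (x : ℕ → ℂ) :
    HasSum (fun n => q ^ (n + 1).choose 2 * coeff n (aabSeries q e x))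
      (∑' p, posAAB.indicator (posWeight q e x) p) := by
  have h1 := (summable_norm_posAAB q hq e x).of_norm.hasSum.tsum_fiberwise
    fun p : List ℕ × List ℕ => (p.1.length, p.2.length)
  simp only [tsum_subtype] at h1
  have h2 : ∀ c : ℕ × ℕ, _ := fun c => (hasSum_posAAB_of_length q hq e x c.1 c.2).tsum_eq
  simp only [Prod.mk.eta] at h2
  simp only [h2] at h1
  set H : ℕ × ℕ → ℂ := fun c => q ^ (c.1 + c.2 + 1).choose 2 *
    (coeff c.1 (chainSeries q x 3 - chainSeries q x 4) * coeff c.2 (invPochSqSeries q e) +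
      coeff c.1 (chainSeries q x 6 - chainSeries q x 7 + chainSeries q x 8) *
        coeff c.2 (invPochSqSeries q (e * q))) with hH
  have hinj : Function.Injective fun c : ℕ × ℕ => (c.1, 2 * c.2) := by
    rintro ⟨i, j⟩ ⟨i', j'⟩ h
    simp only [Prod.mk.injEq] at h ⊢
    omega
  have h3 : HasSum H (∑' p, posAAB.indicator (posWeight q e x) p) := by
    refine (hinj.hasSum_iff fun c hc => ?_).1 h1
    have hc2 : ¬ Even c.2 := by
      rintro ⟨k, hk⟩
      exact hc ⟨(c.1, k), by ext <;> (simp; try omega)⟩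
    simp [hH, invPochSqSeries, hc2]
  refine HasSum.sigma
    (Finset.HasAntidiagonal.sigmaAntidiagonalEquivProd.hasSum_iff.2 h3) fun n => ?_
  refine (congrArg (fun z => HasSum _ z) ?_).mpr
    (Finset.hasSum (Finset.HasAntidiagonal.antidiagonal n) H)
  rw [aabSeries, map_add, coeff_mul, coeff_mul, ← Finset.sum_add_distrib, Finset.mul_sum]
  refine Finset.sum_congr rfl fun c hc => ?_
  rw [hH, ← Finset.HasAntidiagonal.mem_antidiagonal.1 hc]

/-- The weights of the primary and secondary colors, by index. -/
def colorWeight (a b c d : ℂ) : ℕ → ℂ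
  | 0 => a * b
  | 1 => a * c
  | 2 => a * d
  | 3 => a
  | 4 => b * c
  | 5 => b * d
  | 6 => b
  | 7 => c * d
  | 8 => c
  | _ => d

/-- The infinite product dividing the generating function of quaternary partitions before the
substitution `z ^ n ↦ q ^ (n (n + 1) / 2)`. -/
noncomputable def aabProd (q a b c d : ℂ) : ℂ⟦X⟧ :=
  rescale (a * b * q) (pochSeries q) * rescale (a * c * q) (pochSeries q) *
    rescale (a * d * q) (pochSeries q) * rescale (b * c * q) (pochSeries q) *
    rescale (b * d * q) (pochSeries q) * rescale (c * d * q) (pochSeries q) *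
    rescale a (invPochSeries q) * rescale b (invPochSeries q) *
    rescale c (invPochSeries q) * rescale d (invPochSeries q) *
    invPochSqSeries q (a * b * c * d)

/-- The polynomial cofactor of `aabProd`; here `a`, `b`, `c`, `d`, `z` are elements of a ring. -/
def aabNumer {R : Type*} [CommRing R] (a b c d z : R) : R :=
  1 + (a * b * c + a * b * d + a * c * d + b * c * d - a * b * c * d) * z ^ 2 +
    a * b * c * d * (a + b + c + d - 1) * z ^ 3 + (a * b * c * d) ^ 2 * z ^ 5

theorem aabSeries_colorWeight (q : ℂ) (hq : ‖q‖ < 1) (a b c d : ℂ) :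
    aabSeries q (a * b * c * d) (colorWeight a b c d) =
      aabNumer (C a) (C b) (C c) (C d) X * aabProd q a b c d := by
  have h1 := rescale_invPochSeries q hq a
  have h2 := rescale_invPochSeries q hq b
  have h3 := rescale_pochSeries q hq (b * c)
  have h4 := rescale_pochSeries q hq (b * d)
  have h5 := rescale_pochSeries q hq (c * d)
  have h6 := invPochSqSeries_mul q hq (a * b * c * d)
  simp only [map_mul] at h3 h4 h5 h6
  simp only [aabSeries, chainSeries, Finset.prod_range_succ, Finset.prod_range_zero, colorSeries,
    secIdx, colorWeight]
  norm_num
  rw [h6, h3, h4, h5, h1, h2, aabProd, aabNumer]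
  ring

theorem aabProd_rotate (q a b c d : ℂ) : aabProd q b c d a = aabProd q a b c d := by
  rw [aabProd, aabProd, mul_comm b a, mul_comm c a, mul_comm d a,
    show b * c * d * a = a * b * c * d by ring]
  ring

theorem aabNumer_rotate {R : Type*} [CommRing R] (a b c d z : R) :
    aabNumer b c d a z = aabNumer a b c d z := by
  unfold aabNumer
  ring

/-- The polynomial identity behind the `q`-difference equation. -/
theorem aabNumer_sub {R : Type*} [CommRing R] (q a b c d z : R) :
    aabNumer a b c d z * ((1 + a * d * q * z) * (1 + b * d * q * z) * (1 + c * d * q * z)) -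
        (1 + d * q) * aabNumer a b c (d * q) z * ((1 - d * z) * (1 - a * b * c * d * z ^ 2)) =
      d * (z * ((1 + a * b * z) * (1 + a * c * z) * (1 + b * c * z)) *
          ((1 + a * d * q * z) * (1 + b * d * q * z) * (1 + c * d * q * z)) -
        q * ((1 - a * z) * (1 - b * z) * (1 - c * z) * (1 - d * z)) *
          ((1 - a * b * c * d * z ^ 2) * (1 - a * b * c * d * q * z ^ 2))) := by
  unfold aabNumer
  ring

/-- The series whose rescaling defect is the defect of the `q`-difference equation. -/
noncomputable def certSeries (q a b c d : ℂ) : ℂ⟦X⟧ :=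
  rescale (a * b) (pochSeries q) * rescale (a * c) (pochSeries q) *
    rescale (b * c) (pochSeries q) * rescale (a * d * q) (pochSeries q) *
    rescale (b * d * q) (pochSeries q) * rescale (c * d * q) (pochSeries q) *
    rescale a (invPochSeries q) * rescale b (invPochSeries q) *
    rescale c (invPochSeries q) * rescale d (invPochSeries q) *
    invPochSqSeries q (a * b * c * d)

theorem posRadius_certSeries (q : ℂ) (hq : ‖q‖ < 1) (a b c d : ℂ) :
    PosRadius (certSeries q a b c d) := by
  have h1 := posRadius_rescale_pochSeries q hq
  have h2 := posRadius_rescale_invPochSeries q hq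
  exact ((((((((((h1 _).mul (h1 _)).mul (h1 _)).mul (h1 _)).mul (h1 _)).mul (h1 _)).mul
    (h2 _)).mul (h2 _)).mul (h2 _)).mul (h2 _)).mul (posRadius_invPochSqSeries q hq _)

theorem aabSeries_sub (q : ℂ) (hq : ‖q‖ < 1) (a b c d : ℂ) :
    aabNumer (C a) (C b) (C c) (C d) X * aabProd q a b c d -
        C (1 + d * q) * (aabNumer (C a) (C b) (C c) (C (d * q)) X * aabProd q a b c (d * q)) =
      C d * (X * certSeries q a b c d - C q * rescale q (certSeries q a b c d)) := by
  have h1 := rescale_invPochSeries q hq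
  have h2 := rescale_pochSeries q hq
  have h3 := invPochSqSeries_mul q hq
  set V : ℂ⟦X⟧ := rescale (a * b * q) (pochSeries q) * rescale (a * c * q) (pochSeries q) *
    rescale (b * c * q) (pochSeries q) * rescale (a * d * q * q) (pochSeries q) *
    rescale (b * d * q * q) (pochSeries q) * rescale (c * d * q * q) (pochSeries q) *
    rescale a (invPochSeries q) * rescale b (invPochSeries q) *
    rescale c (invPochSeries q) * rescale d (invPochSeries q) *
    invPochSqSeries q (a * b * c * d) with hV
  have e1 : aabProd q a b c d = (1 + C a * C d * C q * X) * (1 + C b * C d * C q * X) *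
      (1 + C c * C d * C q * X) * V := by
    rw [aabProd, h2 (a * d * q), h2 (b * d * q), h2 (c * d * q), hV]
    simp only [map_mul]
    ring
  have e2 : aabProd q a b c (d * q) = (1 - C d * X) * (1 - C a * C b * C c * C d * X ^ 2) * V := by
    rw [aabProd, h1 d, ← mul_assoc a d q, ← mul_assoc b d q, ← mul_assoc c d q,
      ← mul_assoc (a * b * c) d q, h3, hV]
    simp only [map_mul]
    ring
  have e3 : certSeries q a b c d = (1 + C a * C b * X) * (1 + C a * C c * X) *
      (1 + C b * C c * X) * ((1 + C a * C d * C q * X) * (1 + C b * C d * C q * X) *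
      (1 + C c * C d * C q * X)) * V := by
    rw [certSeries, h2 (a * d * q), h2 (b * d * q), h2 (c * d * q), h2 (a * b), h2 (a * c),
      h2 (b * c), hV]
    simp only [map_mul]
    ring
  have e4 : rescale q (certSeries q a b c d) = (1 - C a * X) * (1 - C b * X) * (1 - C c * X) *
      (1 - C d * X) * ((1 - C a * C b * C c * C d * X ^ 2) *
      (1 - C a * C b * C c * C d * C q * X ^ 2)) * V := by
    rw [certSeries]
    simp only [map_mul, rescale_rescale, rescale_invPochSqSeries, h1, h3]
    rw [hV]
    ring
  rw [e1, e2, e4, e3]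
  simp only [map_add, map_mul, map_one]
  linear_combination V * aabNumer_sub (C q) (C a) (C b) (C c) (C d) X

/-- The position of a colored part. -/
def partPos (x : ℕ × C10) : ℕ := 10 * x.1 + x.2.idx

theorem partPos_bijective : Function.Bijective partPos := by
  constructor
  · rintro ⟨k, p⟩ ⟨k', p'⟩ h
    cases p <;> cases p' <;> simp only [partPos, C10.idx, Prod.mk.injEq] at h ⊢ <;>
      first | (exfalso; omega) | exact ⟨by omega, trivial⟩
  · intro s
    have hs : ∃ p : C10, p.idx = s % 10 := by
      have h := Nat.mod_lt s (show 10 > 0 by norm_num)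
      generalize s % 10 = i at h
      interval_cases i
      exacts [⟨.ab, rfl⟩, ⟨.ac, rfl⟩, ⟨.ad, rfl⟩, ⟨.a, rfl⟩, ⟨.bc, rfl⟩, ⟨.bd, rfl⟩, ⟨.b, rfl⟩,
        ⟨.cd, rfl⟩, ⟨.c, rfl⟩, ⟨.d, rfl⟩]
    obtain ⟨p, hp⟩ := hs
    exact ⟨(s / 10, p), by rw [partPos, hp, Nat.div_add_mod]⟩

theorem partPos_mod (x : ℕ × C10) : partPos x % 10 = x.2.idx := by
  obtain ⟨k, p⟩ := x
  cases p <;> simp only [partPos, C10.idx] <;> omega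

theorem partPos_div (x : ℕ × C10) : partPos x / 10 = x.1 := by
  obtain ⟨k, p⟩ := x
  cases p <;> simp only [partPos, C10.idx] <;> omega

theorem rhd_iff_partGap_le (x y : ℕ × C10) : Rhd x y ↔ partGap (partPos y) ≤ partPos x := by
  rw [partGap, partPos_mod]
  obtain ⟨k, p⟩ := x
  obtain ⟨l, r⟩ := y
  cases p <;> cases r <;> simp [Rhd, partPos, C10.primary, C10.idx, secIdx] <;> omega

theorem inPS_iff_isPartPos (x : ℕ × C10) : InPS x ↔ IsPartPos (partPos x) := by
  obtain ⟨k, p⟩ := x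
  cases p <;> simp [InPS, IsPartPos, partPos, C10.primary, C10.idx] <;> omega

theorem rhd_chain_iff_pairwise (l : List (ℕ × C10)) : l.IsChain Rhd ↔ l.Pairwise Rhd := by
  have : Trans Rhd Rhd Rhd := by
    refine ⟨fun {x y z} h1 h2 => ?_⟩
    rw [rhd_iff_partGap_le] at *
    have := lt_partGap (partPos y)
    omega
  exact List.isChain_iff_pairwise

theorem add_four_chain_iff_pairwise (Q : List ℕ) :
    Q.IsChain (fun x y => y + 4 ≤ x) ↔ Q.Pairwise (fun x y => y + 4 ≤ x) := by
  have : Trans (fun x y : ℕ => y + 4 ≤ x) (fun x y => y + 4 ≤ x) (fun x y => y + 4 ≤ x) :=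
    ⟨fun {x y z} h1 h2 => by omega⟩
  exact List.isChain_iff_pairwise

theorem isAAB_iff_mem_posAAB (p : List (ℕ × C10) × List ℕ) :
    IsAAB p.1 p.2 ↔ (p.1.map partPos, p.2) ∈ posAAB := by
  have h1 : 13 ∈ p.1.map partPos ↔ (1, C10.a) ∈ p.1 :=
    List.mem_map_of_injective (a := (1, C10.a)) partPos_bijective.1
  have h2 := rhd_chain_iff_pairwise p.1
  have h3 := add_four_chain_iff_pairwise p.2
  have h4 : IsAAB p.1 p.2 ↔ (∀ x ∈ p.1, InPS x) ∧ p.1.IsChain Rhd ∧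
      p.2.IsChain (fun x y => y + 4 ≤ x) ∧
      ∀ K ∈ p.2, 4 + 2 * p.1.length - (if (1, C10.a) ∈ p.1 then 1 else 0) ≤ K := Iff.rfl
  have h5 : (p.1.map partPos, p.2) ∈ posAAB ↔
      ((p.1.map partPos).Pairwise (fun x y => partGap y ≤ x) ∧
        ∀ s ∈ p.1.map partPos, IsPartPos s) ∧ p.2.Pairwise (fun x y => y + 4 ≤ x) ∧
      ∀ K ∈ p.2, 4 + 2 * (p.1.map partPos).length -
        (if 13 ∈ p.1.map partPos then 1 else 0) ≤ K := Iff.rfl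
  simp only [h4, h5, h2, h3, h1, List.pairwise_map, ← rhd_iff_partGap_le, List.forall_mem_map,
    ← inPS_iff_isPartPos, List.length_map]
  tauto

/-- The monomial of a quaternary partition in the generating function. -/
noncomputable def aabWeight (q a b c d : ℂ) (p : List (ℕ × C10) × List ℕ) : ℂ :=
  a ^ (p.1.countP (fun x => x.2.hasA) + p.2.length) *
    b ^ (p.1.countP (fun x => x.2.hasB) + p.2.length) *
    c ^ (p.1.countP (fun x => x.2.hasC) + p.2.length) *
    d ^ (p.1.countP (fun x => x.2.hasD) + p.2.length) *
    q ^ ((p.1.map Prod.fst).sum + p.2.sum)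

theorem posWeight_partPos (q a b c d : ℂ) (p : List (ℕ × C10) × List ℕ) :
    posWeight q (a * b * c * d) (colorWeight a b c d) (p.1.map partPos, p.2) =
      aabWeight q a b c d p := by
  obtain ⟨l, Q⟩ := p
  have h1 : (Q.map fun k => a * b * c * d * q ^ k).prod =
      (a * b * c * d) ^ Q.length * q ^ Q.sum := by
    induction Q with
    | nil => simp
    | cons k Q ih =>
      rw [List.map_cons, List.prod_cons, ih, List.length_cons, List.sum_cons, pow_succ, pow_add]
      ring
  have h2 : ((l.map partPos).map (partWeight q (colorWeight a b c d))).prod =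
      a ^ l.countP (fun x => x.2.hasA) * b ^ l.countP (fun x => x.2.hasB) *
        c ^ l.countP (fun x => x.2.hasC) * d ^ l.countP (fun x => x.2.hasD) *
        q ^ (l.map Prod.fst).sum := by
    induction l with
    | nil => simp
    | cons x l ih =>
      rw [List.map_cons, List.map_cons, List.prod_cons, ih, partWeight, partPos_mod, partPos_div,
        List.map_cons, List.sum_cons, pow_add q]
      obtain ⟨k, p⟩ := x
      cases p <;> simp [colorWeight, C10.idx, C10.hasA, C10.hasB, C10.hasC,
        C10.hasD] <;> ring
  rw [posWeight, h1, h2, aabWeight]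
  ring

/-- The generating function of quaternary partitions. -/
noncomputable def aabGen (q a b c d : ℂ) : ℂ :=
  ∑' p : {p : List (ℕ × C10) × List ℕ // IsAAB p.1 p.2}, aabWeight q a b c d p

theorem map_partPos_bijective : Function.Bijective
    fun p : List (ℕ × C10) × List ℕ => (p.1.map partPos, p.2) := by
  constructor
  · rintro ⟨l, Q⟩ ⟨l', Q'⟩ h
    obtain ⟨h1, h2⟩ := Prod.mk.inj h
    exact Prod.ext (List.map_injective_iff.2 partPos_bijective.1 h1) h2
  · rintro ⟨l, Q⟩
    obtain ⟨l', h⟩ := List.map_surjective_iff.2 partPos_bijective.2 l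
    exact ⟨(l', Q), Prod.ext h rfl⟩

theorem indicator_posWeight_partPos (q a b c d : ℂ) (p : List (ℕ × C10) × List ℕ) :
    posAAB.indicator (posWeight q (a * b * c * d) (colorWeight a b c d))
        (p.1.map partPos, p.2) =
      {p : List (ℕ × C10) × List ℕ | IsAAB p.1 p.2}.indicator (aabWeight q a b c d) p := by
  by_cases hp : IsAAB p.1 p.2
  · rw [Set.indicator_of_mem ((isAAB_iff_mem_posAAB p).1 hp), Set.indicator_of_mem (by exact hp),
      posWeight_partPos]
  · rw [Set.indicator_of_notMem (mt (isAAB_iff_mem_posAAB p).2 hp),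
      Set.indicator_of_notMem (by exact hp)]

theorem summable_norm_aabWeight (q : ℂ) (hq : ‖q‖ < 1) (a b c d : ℂ) :
    Summable fun p : {p : List (ℕ × C10) × List ℕ // IsAAB p.1 p.2} =>
      ‖aabWeight q a b c d p‖ := by
  have h := (summable_norm_posAAB q hq (a * b * c * d) (colorWeight a b c d)).comp_injective
    map_partPos_bijective.1
  have h1 := h.comp_injective
    (Subtype.val_injective (p := fun p : List (ℕ × C10) × List ℕ => IsAAB p.1 p.2))
  refine h1.congr fun p => ?_
  rw [Function.comp_apply, Function.comp_apply, indicator_posWeight_partPos,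
    Set.indicator_of_mem (by exact p.2)]

theorem tsum_posAAB (q a b c d : ℂ) :
    ∑' p, posAAB.indicator (posWeight q (a * b * c * d) (colorWeight a b c d)) p =
      aabGen q a b c d := by
  rw [← (Equiv.ofBijective _ map_partPos_bijective).tsum_eq]
  simp only [Equiv.ofBijective_apply, indicator_posWeight_partPos]
  rw [← tsum_subtype]
  rfl

theorem hasSum_aabGen (q : ℂ) (hq : ‖q‖ < 1) (a b c d : ℂ) :
    HasSum (fun n => q ^ (n + 1).choose 2 *
      coeff n (aabNumer (C a) (C b) (C c) (C d) X * aabProd q a b c d)) (aabGen q a b c d) := by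
  rw [← aabSeries_colorWeight q hq, ← tsum_posAAB]
  exact hasSum_aabSeries q hq _ _

theorem aabGen_rotate (q : ℂ) (hq : ‖q‖ < 1) (a b c d : ℂ) :
    aabGen q b c d a = aabGen q a b c d := by
  have h := hasSum_aabGen q hq b c d a
  rw [aabNumer_rotate, aabProd_rotate] at h
  exact h.unique (hasSum_aabGen q hq a b c d)

theorem aabGen_eq_mul_last (q : ℂ) (hq : ‖q‖ < 1) (a b c d : ℂ) :
    aabGen q a b c d = (1 + d * q) * aabGen q a b c (d * q) := by
  have h1 := (hasSum_aabGen q hq a b c d).sub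
    ((hasSum_aabGen q hq a b c (d * q)).mul_left (1 + d * q))
  have h2 := ((posRadius_certSeries q hq a b c d).hasSum_X_mul_sub_rescale q hq).mul_left d
  rw [mul_zero] at h2
  refine sub_eq_zero.1 (h1.unique (h2.congr_fun fun n => ?_))
  have h3 := congrArg (coeff n) (aabSeries_sub q hq a b c d)
  rw [map_sub, coeff_C_mul, coeff_C_mul] at h3
  linear_combination q ^ (n + 1).choose 2 * h3

theorem aabGen_eq_mul (q : ℂ) (hq : ‖q‖ < 1) (a b c d : ℂ) :
    aabGen q a b c d = (1 + a * q) * (1 + b * q) * (1 + c * q) * (1 + d * q) *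
      aabGen q (a * q) (b * q) (c * q) (d * q) := by
  rw [aabGen_eq_mul_last q hq a b c d, ← aabGen_rotate q hq a b c (d * q),
    aabGen_eq_mul_last q hq b c (d * q) a, ← aabGen_rotate q hq b c (d * q) (a * q),
    aabGen_eq_mul_last q hq c (d * q) (a * q) b, ← aabGen_rotate q hq c (d * q) (a * q) (b * q),
    aabGen_eq_mul_last q hq (d * q) (a * q) (b * q) c,
    ← aabGen_rotate q hq (d * q) (a * q) (b * q) (c * q)]
  ring

theorem aabGen_eq_prod_mul (q : ℂ) (hq : ‖q‖ < 1) (a b c d : ℂ) (n : ℕ) :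
    aabGen q a b c d = (∏ k ∈ Finset.range n, (1 + a * q ^ (k + 1))) *
      (∏ k ∈ Finset.range n, (1 + b * q ^ (k + 1))) *
      (∏ k ∈ Finset.range n, (1 + c * q ^ (k + 1))) *
      (∏ k ∈ Finset.range n, (1 + d * q ^ (k + 1))) *
      aabGen q (a * q ^ n) (b * q ^ n) (c * q ^ n) (d * q ^ n) := by
  induction n with
  | zero => simp
  | succ n ih =>
    rw [ih, aabGen_eq_mul q hq (a * q ^ n) (b * q ^ n) (c * q ^ n) (d * q ^ n)]
    simp only [Finset.prod_range_succ, pow_succ, ← mul_assoc]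
    ring

/-- The total degree of a quaternary partition in the weights of the primary colors. -/
def aabDegree (p : List (ℕ × C10) × List ℕ) : ℕ :=
  (p.1.countP (fun x => x.2.hasA) + p.2.length) + (p.1.countP (fun x => x.2.hasB) + p.2.length) +
    (p.1.countP (fun x => x.2.hasC) + p.2.length) +
    (p.1.countP (fun x => x.2.hasD) + p.2.length)

theorem length_le_aabDegree (p : List (ℕ × C10) × List ℕ) :
    p.1.length + p.2.length ≤ aabDegree p := by
  obtain ⟨l, Q⟩ := p
  have h : l.length ≤ l.countP (fun x => x.2.hasA) + l.countP (fun x => x.2.hasB) +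
      l.countP (fun x => x.2.hasC) + l.countP (fun x => x.2.hasD) := by
    induction l with
    | nil => simp
    | cons x l ih =>
      obtain ⟨k, p⟩ := x
      have hp : 1 ≤ (if p.hasA then 1 else 0) + (if p.hasB then 1 else 0) +
          (if p.hasC then 1 else 0) + (if p.hasD then 1 else 0) := by
        cases p <;> decide
      simp only [List.countP_cons, List.length_cons]
      omega
  simp only [aabDegree]
  omega

theorem aabWeight_mul (q a b c d t : ℂ) (p : List (ℕ × C10) × List ℕ) :
    aabWeight q (a * t) (b * t) (c * t) (d * t) p = t ^ aabDegree p * aabWeight q a b c d p := by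
  simp only [aabWeight, aabDegree, mul_pow, pow_add t]
  ring

theorem tendsto_aabGen (q : ℂ) (hq : ‖q‖ < 1) (a b c d : ℂ) :
    Tendsto (fun n : ℕ => aabGen q (a * q ^ n) (b * q ^ n) (c * q ^ n) (d * q ^ n)) atTop
      (𝓝 1) := by
  classical
  have hnil : IsAAB [] [] := by
    refine ⟨?_, List.isChain_nil, List.isChain_nil, ?_⟩ <;> simp
  set o : {p : List (ℕ × C10) × List ℕ // IsAAB p.1 p.2} := ⟨([], []), hnil⟩ with ho
  have h := tendsto_tsum_of_dominated_convergence (𝓕 := atTop)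
    (f := fun (n : ℕ) (p : {p : List (ℕ × C10) × List ℕ // IsAAB p.1 p.2}) =>
      aabWeight q (a * q ^ n) (b * q ^ n) (c * q ^ n) (d * q ^ n) p)
    (g := fun p => if p = o then 1 else 0) (summable_norm_aabWeight q hq a b c d) ?_ ?_
  · simp only [tsum_ite_eq] at h
    exact h
  · intro p
    by_cases hp : p = o
    · subst hp
      simp [ho, aabWeight]
    · rw [if_neg hp]
      have hdeg : aabDegree p ≠ 0 := by
        intro h0
        have h1 := length_le_aabDegree p
        refine hp (Subtype.ext (Prod.ext ?_ ?_))
        · exact List.length_eq_zero_iff.1 (by omega)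
        · exact List.length_eq_zero_iff.1 (by omega)
      have h1 := ((tendsto_pow_atTop_nhds_zero_of_norm_lt_one hq).pow (aabDegree p)).mul_const
        (aabWeight q a b c d p)
      rw [zero_pow hdeg, zero_mul] at h1
      exact h1.congr fun n => (aabWeight_mul q a b c d (q ^ n) p).symm
  · refine Eventually.of_forall fun n p => ?_
    rw [aabWeight_mul, norm_mul, norm_pow, norm_pow]
    exact mul_le_of_le_one_left (norm_nonneg _)
      (pow_le_one₀ (by positivity) (pow_le_one₀ (norm_nonneg _) hq.le))

theorem tendsto_prod_one_add_mul_pow (q : ℂ) (hq : ‖q‖ < 1) (a : ℂ) :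
    Tendsto (fun n => ∏ k ∈ Finset.range n, (1 + a * q ^ (k + 1))) atTop
      (𝓝 (∏' k : ℕ, (1 + a * q ^ (k + 1)))) := by
  refine (multipliable_one_add_of_summable ?_).hasProd.tendsto_prod_nat
  have h := ((summable_nat_add_iff 1).2 (summable_geometric_of_lt_one (norm_nonneg q) hq)).mul_left
    ‖a‖
  simpa only [norm_mul, norm_pow] using h

theorem aabGen_eq_tprod (q : ℂ) (hq : ‖q‖ < 1) (a b c d : ℂ) :
    aabGen q a b c d = (∏' k : ℕ, (1 + a * q ^ (k + 1))) * (∏' k : ℕ, (1 + b * q ^ (k + 1))) *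
        (∏' k : ℕ, (1 + c * q ^ (k + 1))) * ∏' k : ℕ, (1 + d * q ^ (k + 1)) := by
  have h := ((((tendsto_prod_one_add_mul_pow q hq a).mul
    (tendsto_prod_one_add_mul_pow q hq b)).mul (tendsto_prod_one_add_mul_pow q hq c)).mul
    (tendsto_prod_one_add_mul_pow q hq d)).mul (tendsto_aabGen q hq a b c d)
  rw [mul_one] at h
  exact tendsto_nhds_unique
    (tendsto_const_nhds.congr fun n => aabGen_eq_prod_mul q hq a b c d n) h

theorem tsum_Baab (q : ℂ) (hq : ‖q‖ < 1) (a b c d : ℂ) :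
    ∑' x : ℕ × ℕ × ℕ × ℕ × ℕ,
        (Baab x.1 x.2.1 x.2.2.1 x.2.2.2.1 x.2.2.2.2 : ℂ) *
          a ^ x.1 * b ^ x.2.1 * c ^ x.2.2.1 * d ^ x.2.2.2.1 * q ^ x.2.2.2.2 =
      aabGen q a b c d := by
  let g : {p : List (ℕ × C10) × List ℕ // IsAAB p.1 p.2} → ℕ × ℕ × ℕ × ℕ × ℕ := fun p =>
    (p.1.1.countP (fun x => x.2.hasA) + p.1.2.length,
      p.1.1.countP (fun x => x.2.hasB) + p.1.2.length,
      p.1.1.countP (fun x => x.2.hasC) + p.1.2.length,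
      p.1.1.countP (fun x => x.2.hasD) + p.1.2.length,
      (p.1.1.map Prod.fst).sum + p.1.2.sum)
  have h := (summable_norm_aabWeight q hq a b c d).of_norm.hasSum.tsum_fiberwise g
  rw [aabGen, ← h.tsum_eq]
  refine tsum_congr fun x => ?_
  obtain ⟨u, v, w, t, n⟩ := x
  have hg : ∀ p, g p = (u, v, w, t, n) ↔ (p.1.1.map Prod.fst).sum + p.1.2.sum = n ∧
      p.1.1.countP (fun x => x.2.hasA) + p.1.2.length = u ∧
      p.1.1.countP (fun x => x.2.hasB) + p.1.2.length = v ∧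
      p.1.1.countP (fun x => x.2.hasC) + p.1.2.length = w ∧
      p.1.1.countP (fun x => x.2.hasD) + p.1.2.length = t := fun p => by
    simp only [g, Prod.mk.injEq]
    tauto
  have hconst : ∀ p : g ⁻¹' {(u, v, w, t, n)},
      aabWeight q a b c d p.1.1 = a ^ u * b ^ v * c ^ w * d ^ t * q ^ n := fun p => by
    obtain ⟨h1, h2, h3, h4, h5⟩ := (hg p.1).1 p.2
    rw [aabWeight, h1, h2, h3, h4, h5]
  have hcard : Baab u v w t n = Nat.card (g ⁻¹' {(u, v, w, t, n)}) :=
    Nat.card_congr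
      { toFun := fun p => ⟨⟨p.1, p.2.1⟩, (hg _).2 p.2.2⟩
        invFun := fun p => ⟨p.1.1, p.1.2, (hg _).1 p.2⟩
        left_inv := fun _ => rfl
        right_inv := fun _ => rfl }
  rw [tsum_congr hconst, tsum_const, nsmul_eq_mul, ← hcard]
  ring

end AAB

/-- The identity
`∑ B(u,v,w,t,n) a^u b^v c^w d^t q^n = (−aq;q)_∞ (−bq;q)_∞ (−cq;q)_∞ (−dq;q)_∞`
for `|q| < 1` and `|a|, |b|, |c|, |d|` small. -/
theorem alladi_andrews_berkovich_series (a b c d q : ℂ) (hq : ‖q‖ < 1)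
    (ha : ‖a‖ < 1) (hb : ‖b‖ < 1) (hc : ‖c‖ < 1) (hd : ‖d‖ < 1) :
    ∑' x : ℕ × ℕ × ℕ × ℕ × ℕ,
        (Baab x.1 x.2.1 x.2.2.1 x.2.2.2.1 x.2.2.2.2 : ℂ) *
          a ^ x.1 * b ^ x.2.1 * c ^ x.2.2.1 * d ^ x.2.2.2.1 * q ^ x.2.2.2.2 =
      (∏' k : ℕ, (1 + a * q ^ (k + 1))) * (∏' k : ℕ, (1 + b * q ^ (k + 1))) *
        (∏' k : ℕ, (1 + c * q ^ (k + 1))) * ∏' k : ℕ, (1 + d * q ^ (k + 1)) := by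
  rw [AAB.tsum_Baab q hq, AAB.aabGen_eq_tprod q hq]
end
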